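/- arXiv:2009.05869 — 3 statements merged into one kernel-verified Lean document; each statement's English description precedes it below -/
import Mathlib

section
/- There exists an absolute constant C > 0 such that for all integers k ≥ 1 and n ≥ 2, a uniformly random word w ~ [k]^n satisfies | E[LNDS(w)] − n/k − 2√n | ≤ 2√n · C · ( k^{−2/3} + (k² + k·log n)/n^{1/2} ). -/
/-- Length of a longest non-decreasing subsequence of a word. -/
noncomputable def LNDS {α : Type*} [LinearOrder α] (w : List α) : ℕ :=
  sSup {n | ∃ u : List α, u.Sublist w ∧ u.Chain' (· ≤ ·) ∧ u.length = n}

/-- Expected LNDS length of a uniformly random word of length `n` over the alphabet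
`[k] = {1, …, k}`. -/
noncomputable def expLNDS (k n : ℕ) : ℝ :=
  (∑ u : Fin n → Fin k, (LNDS (List.ofFn fun i => (u i : ℕ) + 1) : ℝ)) / (k : ℝ) ^ n


/-- The effect of appending the letter `a` to a word on the sequence whose `b`-th entry is the
length of a longest non-decreasing subsequence using only letters at most `b`. -/
def levelStep (l : ℕ → ℕ) (a b : ℕ) : ℕ := if b < a then l b else max (l b) (l a + 1)

/-- The state reached from `s` by reading the letters of `u` from left to right. -/
def runWord {S : Type*} (step : S → ℕ → S) (s : S) {k n : ℕ} (u : Fin n → Fin k) : S :=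
  (List.ofFn fun i => (u i : ℕ)).foldl step s

theorem runWord_zero {S : Type*} (step : S → ℕ → S) (s : S) {k : ℕ} (u : Fin 0 → Fin k) :
    runWord step s u = s := by
  simp [runWord]

theorem sum_runWord_snoc {S M : Type*} [AddCommMonoid M] (step : S → ℕ → S) (s : S) (k n : ℕ)
    (F : S → M) :
    ∑ u : Fin (n + 1) → Fin k, F (runWord step s u) =
      ∑ u : Fin n → Fin k, ∑ a ∈ Finset.range k, F (step (runWord step s u) a) := by
  rw [← (Fin.snocEquiv fun _ : Fin (n + 1) => Fin k).sum_comp, Fintype.sum_prod_type_right]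
  refine Finset.sum_congr rfl fun u _ => ?_
  rw [Finset.sum_range]
  refine Finset.sum_congr rfl fun a _ => ?_
  simp only [runWord, Fin.snocEquiv, Equiv.coe_fn_mk]
  rw [List.ofFn_succ', List.concat_eq_append, List.foldl_append]
  simp

theorem sum_runWord_cons {S M : Type*} [AddCommMonoid M] (step : S → ℕ → S) (s : S) (k n : ℕ)
    (F : S → M) :
    ∑ u : Fin (n + 1) → Fin k, F (runWord step s u) =
      ∑ a ∈ Finset.range k, ∑ u : Fin n → Fin k, F (runWord step (step s a) u) := by
  rw [← (Fin.consEquiv fun _ : Fin (n + 1) => Fin k).sum_comp, Fintype.sum_prod_type,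
    Finset.sum_range]
  refine Finset.sum_congr rfl fun a _ => Finset.sum_congr rfl fun u _ => ?_
  simp [runWord, Fin.consEquiv]

theorem runWord_hom {S T : Type*} (step : S → ℕ → S) (step' : T → ℕ → T) (φ : S → T)
    (P : S → Prop) (k : ℕ) (hP : ∀ s a, a < k → P s → P (step s a))
    (h : ∀ s a, a < k → P s → φ (step s a) = step' (φ s) a) (s : S) (hs : P s) {n : ℕ}
    (u : Fin n → Fin k) :
    φ (runWord step s u) = runWord step' (φ s) u ∧ P (runWord step s u) := by
  have key : ∀ (w : List ℕ) (s : S), P s → (∀ a ∈ w, a < k) →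
      φ (w.foldl step s) = w.foldl step' (φ s) ∧ P (w.foldl step s) := by
    intro w
    induction w with
    | nil => intro s hs _; exact ⟨rfl, hs⟩
    | cons a w ih =>
      intro s hs hw
      have ha := hw a List.mem_cons_self
      simp only [List.foldl_cons]
      rw [← h s a ha hs]
      exact ih _ (hP s a ha hs) fun b hb => hw b (List.mem_cons_of_mem _ hb)
  refine key _ s hs fun a ha => ?_
  obtain ⟨i, rfl⟩ := (List.mem_ofFn' _ _).1 ha
  exact (u i).2

theorem isGreatest_foldl_levelStep (w : List ℕ) (b : ℕ) :
    IsGreatest {n | ∃ u : List ℕ, u.Sublist w ∧ u.IsChain (· ≤ ·) ∧ (∀ x ∈ u, x ≤ b) ∧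
      u.length = n} (w.foldl levelStep (fun _ => 0) b) := by
  induction w using List.reverseRecOn generalizing b with
  | nil =>
    constructor
    · exact ⟨[], by simp⟩
    · rintro n ⟨u, hu, -, -, rfl⟩
      simp [List.sublist_nil.1 hu]
  | append_singleton w a ih =>
    rw [List.foldl_append]
    simp only [List.foldl_cons, List.foldl_nil]
    generalize w.foldl levelStep (fun _ => 0) = l at ih ⊢
    have old : ∀ n, (∃ u : List ℕ, u.Sublist w ∧ u.IsChain (· ≤ ·) ∧ (∀ x ∈ u, x ≤ b) ∧
        u.length = n) → ∃ u : List ℕ, u.Sublist (w ++ [a]) ∧ u.IsChain (· ≤ ·) ∧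
        (∀ x ∈ u, x ≤ b) ∧ u.length = n := fun n ⟨u, h1, h2⟩ =>
      ⟨u, h1.trans (List.sublist_append_left _ _), h2⟩
    have new : a ≤ b → ∃ u : List ℕ, u.Sublist (w ++ [a]) ∧ u.IsChain (· ≤ ·) ∧
        (∀ x ∈ u, x ≤ b) ∧ u.length = l a + 1 := by
      intro hab
      obtain ⟨u, h1, h2, h3, h4⟩ := (ih a).1
      refine ⟨u ++ [a], List.Sublist.append h1 (List.Sublist.refl _), ?_, ?_, by simp [h4]⟩
      · rw [List.isChain_append]
        refine ⟨h2, by simp, fun x hx y hy => ?_⟩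
        simp only [List.head?_cons, Option.mem_def, Option.some.injEq] at hy
        subst hy
        exact h3 x (List.mem_of_mem_getLast? hx)
      · intro x hx
        rcases List.mem_append.1 hx with hx | hx
        · exact (h3 x hx).trans hab
        · simp at hx; omega
    constructor
    · unfold levelStep
      split_ifs with hb
      · exact old _ (ih b).1
      · rcases max_choice (l b) (l a + 1) with h | h <;> rw [h]
        · exact old _ (ih b).1
        · exact new (not_lt.1 hb)
    · rintro n ⟨u, h1, h2, h3, rfl⟩
      obtain ⟨u1, u2, rfl, hu1, hu2⟩ := List.sublist_append_iff.1 h1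
      rw [List.isChain_append] at h2
      rcases List.sublist_singleton.1 hu2 with rfl | rfl
      · have := (ih b).2 ⟨u1, hu1, h2.1, fun x hx => h3 x (by simp [hx]), rfl⟩
        simp only [List.append_nil, levelStep]
        split_ifs
        · exact this
        · exact this.trans (le_max_left _ _)
      · have hab : a ≤ b := h3 a (by simp)
        have hle : ∀ x ∈ u1, x ≤ a := by
          intro x hx
          have hp := List.isChain_iff_pairwise.1 h2.1
          rcases List.eq_nil_or_concat u1 with rfl | ⟨v, y, rfl⟩
          · simp at hx
          · have hy : y ≤ a := h2.2.2 y (by simp) a (by simp)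
            rw [List.concat_eq_append, List.pairwise_append] at hp
            simp only [List.concat_eq_append, List.mem_append, List.mem_singleton] at hx
            rcases hx with hx | rfl
            · exact (hp.2.2 x hx y (by simp)).trans hy
            · exact hy
        have := (ih a).2 ⟨u1, hu1, h2.1, hle, rfl⟩
        simp only [List.length_append, List.length_singleton, levelStep, not_lt.2 hab, if_false]
        exact le_max_of_le_right (by omega)

theorem LNDS_ofFn {k n : ℕ} (u : Fin n → Fin (k + 1)) :
    LNDS (List.ofFn fun i => (u i : ℕ) + 1) = runWord levelStep (fun _ => 0) u k := by
  have hmap : (List.ofFn fun i => (u i : ℕ) + 1) = (List.ofFn fun i => (u i : ℕ)).map (· + 1) := by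
    rw [List.map_ofFn]; rfl
  have hlt : ∀ a ∈ (List.ofFn fun i => (u i : ℕ)), a ≤ k := by
    intro a ha
    obtain ⟨i, rfl⟩ := (List.mem_ofFn' _ _).1 ha
    exact Nat.lt_succ_iff.1 (u i).2
  rw [hmap, LNDS, runWord, ← (isGreatest_foldl_levelStep _ k).csSup_eq]
  congr 1
  ext m
  constructor
  · rintro ⟨v, h1, h2, h3⟩
    obtain ⟨v', h4, rfl⟩ := List.sublist_map_iff.1 h1
    refine ⟨v', h4, ?_, fun x hx => hlt x (h4.subset hx), by simpa using h3⟩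
    have := (List.isChain_map _).1 h2
    simpa using this
  · rintro ⟨v, h1, h2, -, h3⟩
    refine ⟨v.map (· + 1), h1.map _, ?_, by simpa using h3⟩
    refine (List.isChain_map _).2 ?_
    simpa using h2


/-- Multiplicities of the letters `1, …, k` in a non-decreasing word. -/
def RowState : ℕ → Type
  | 0 => Unit
  | k + 1 => RowState k × ℕ

/-- Pass a bumped letter (if the flag is set) to a stack of `y` copies of the next letter. -/
def rowFeed {k : ℕ} (r : RowState k × Bool) (y : ℕ) : RowState (k + 1) × Bool :=
  if r.2 then (if y = 0 then ((r.1, 0), true) else ((r.1, y - 1), false)) else ((r.1, y), false)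

/-- Row insertion of a letter smaller than all others (which is itself not recorded). The flag tells
whether the row got longer. -/
def rowZero : (k : ℕ) → RowState k → RowState k × Bool
  | 0, x => (x, true)
  | k + 1, x => rowFeed (rowZero k x.1) x.2

/-- Row insertion of the letter `a`. The flag tells whether the row got longer. -/
def rowStep : (k : ℕ) → RowState k → ℕ → RowState k × Bool
  | 0, x, _ => (x, true)
  | k + 1, x, a => if a = k then ((x.1, x.2 + 1), true) else rowFeed (rowStep k x.1 a) x.2

/-- The number of entries of a row which are at most `b`. -/
def rowLevel : (k : ℕ) → RowState k → ℕ → ℕ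
  | 0, _, _ => 0
  | k + 1, x, b => rowLevel k x.1 b + if b < k then 0 else x.2

/-- The length of a row. -/
def rowSize : (k : ℕ) → RowState k → ℕ
  | 0, _ => 0
  | k + 1, x => rowSize k x.1 + x.2

theorem rowLevel_eq_rowSize (k : ℕ) (x : RowState k) (b : ℕ) (hb : k ≤ b + 1) :
    rowLevel k x b = rowSize k x := by
  induction k generalizing b with
  | zero => rfl
  | succ k ih => simp only [rowLevel, rowSize, ih x.1 b (by omega), if_neg (by omega : ¬ b < k)]

theorem rowLevel_le_rowSize (k : ℕ) (x : RowState k) (b : ℕ) :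
    rowLevel k x b ≤ rowSize k x := by
  induction k generalizing b with
  | zero => simp [rowLevel]
  | succ k ih =>
    have := ih x.1 b
    simp only [rowLevel, rowSize]
    split_ifs <;> omega

theorem rowZero_spec (k : ℕ) (x : RowState k) :
    (∀ b, rowLevel k (rowZero k x).1 b = rowLevel k x b - 1) ∧
      ((rowZero k x).2 = true ↔ rowSize k x = 0) := by
  induction k with
  | zero => simp [rowLevel, rowSize, rowZero]
  | succ k ih =>
    obtain ⟨x, y⟩ := x
    obtain ⟨h1, h2⟩ := ih x
    have hs := rowLevel_eq_rowSize k x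
    have hl := rowLevel_le_rowSize k x
    simp only [rowLevel, rowSize, rowZero, rowFeed]
    generalize rowZero k x = r at *
    obtain ⟨r, J⟩ := r
    simp only at h1 h2 ⊢
    cases J
    · simp only [Bool.false_eq_true, false_iff] at h2
      simp only [Bool.false_eq_true, if_false, false_iff]
      refine ⟨fun b => ?_, by omega⟩
      rw [h1 b]
      split_ifs with hb
      · rfl
      · have := hs b (by omega); omega
    · have h3 := h2.1 rfl
      by_cases hy : y = 0
      · subst hy
        simpa [h3] using h1
      · simp only [if_true, if_neg hy, Bool.false_eq_true, false_iff]
        refine ⟨fun b => ?_, by omega⟩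
        rw [h1 b]
        have := hl b
        split_ifs <;> omega

theorem rowStep_spec (k : ℕ) (x : RowState k) (a : ℕ) (ha : a < k) :
    (∀ b, rowLevel k (rowStep k x a).1 b = levelStep (rowLevel k x) a b) ∧
      rowSize k (rowStep k x a).1 = rowSize k x + (if (rowStep k x a).2 then 1 else 0) := by
  induction k with
  | zero => omega
  | succ k ih =>
    obtain ⟨x, y⟩ := x
    have hs := rowLevel_eq_rowSize k x
    have hl := rowLevel_le_rowSize k x
    by_cases hak : a = k
    · subst hak
      simp only [rowLevel, rowSize, rowStep, levelStep, if_true]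
      refine ⟨fun b => ?_, by omega⟩
      have h1 := hs a (by omega)
      have h2 := hs b
      simp only [lt_irrefl, if_false]
      split_ifs <;> omega
    · obtain ⟨h1, h2⟩ := ih x (by omega)
      have hs' := rowLevel_eq_rowSize k (rowStep k x a).1
      simp only [rowLevel, rowSize, rowStep, rowFeed, if_neg hak, levelStep] at h1 h2 ⊢
      generalize rowStep k x a = r at *
      obtain ⟨r, J⟩ := r
      simp only at h1 h2 hs' ⊢
      have hka : ¬ k < a := by omega
      have h1k := h1 k
      rw [if_neg hka, hs' k (by omega), h2, hs k (by omega)] at h1k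
      have hla := hl a
      cases J
      · simp only [Bool.false_eq_true, if_false] at h1k h2 ⊢
        refine ⟨fun b => ?_, by omega⟩
        rw [h1 b]
        have hb' := hs b
        split_ifs <;> omega
      · simp only [if_true] at h1k ⊢
        by_cases hy : y = 0
        · subst hy
          simp only [if_true] at h2 ⊢
          refine ⟨fun b => ?_, by omega⟩
          rw [h1 b]
          split_ifs <;> omega
        · simp only [if_neg hy, Bool.false_eq_true, if_false] at h2 ⊢
          refine ⟨fun b => ?_, by simp at h2; omega⟩
          rw [h1 b]
          have hb' := hs b
          split_ifs <;> omega

open scoped ENNReal in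
/-- The product of geometric distributions is stationary for row insertion with an additional
source letter of weight `α`, and the row gets longer at rate `α`. -/
theorem tsum_rowState_stationary (α q : ℝ≥0∞) (hq : α * q = 1) (k : ℕ)
    (F : RowState k × Bool → ℝ≥0∞) :
    ∑' x, q ^ rowSize k x * (α * F (rowZero k x) + ∑ a ∈ Finset.range k, F (rowStep k x a)) =
      ∑' x, q ^ rowSize k x * (α * F (x, true) + k * F (x, false)) := by
  induction k with
  | zero => simp [rowZero]
  | succ k ih =>
    have split : ∀ G : RowState (k + 1) → ℝ≥0∞, ∑' x, G x = ∑' (y : ℕ) (x : RowState k), G (x, y) :=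
      fun G => by
        rw [ENNReal.tsum_comm]
        exact ENNReal.tsum_prod' (f := G)
    rw [split, split]
    have e1 : ∀ y : ℕ, ∑' x : RowState k, q ^ rowSize (k + 1) (x, y) *
        (α * F (rowZero (k + 1) (x, y)) + ∑ a ∈ Finset.range (k + 1), F (rowStep (k + 1) (x, y) a))
        = ∑' x : RowState k, q ^ rowSize k x * (q ^ y * (α * F (rowFeed (x, true) y) +
          k * F ((x, y), false) + F ((x, y + 1), true))) := by
      intro y
      have := ih fun r => F (rowFeed r y)
      have e : ∀ x : RowState k, q ^ rowSize (k + 1) (x, y) *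
        (α * F (rowZero (k + 1) (x, y)) + ∑ a ∈ Finset.range (k + 1), F (rowStep (k + 1) (x, y) a))
        = q ^ y * (q ^ rowSize k x * (α * F (rowFeed (rowZero k x) y) +
          ∑ a ∈ Finset.range k, F (rowFeed (rowStep k x a) y))) +
          q ^ rowSize k x * (q ^ y * F ((x, y + 1), true)) := by
        intro x
        rw [Finset.sum_range_succ]
        have : ∑ a ∈ Finset.range k, F (rowStep (k + 1) (x, y) a) =
            ∑ a ∈ Finset.range k, F (rowFeed (rowStep k x a) y) :=
          Finset.sum_congr rfl fun a ha => by
            simp [rowStep, (Finset.mem_range.1 ha).ne]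
        rw [this]
        simp only [rowSize, rowZero, rowStep, if_true, pow_add]
        ring
      rw [tsum_congr e, ENNReal.tsum_add, ENNReal.tsum_mul_left, this, ← ENNReal.tsum_mul_left,
        ← ENNReal.tsum_add]
      refine tsum_congr fun x => ?_
      simp only [rowFeed, Bool.false_eq_true, if_false]
      ring
    rw [tsum_congr e1, ENNReal.tsum_comm]
    conv_rhs => rw [ENNReal.tsum_comm]
    refine tsum_congr fun x => ?_
    rw [ENNReal.tsum_mul_left]
    have e2 : ∀ y : ℕ, q ^ rowSize (k + 1) (x, y) * (α * F ((x, y), true) +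
        ((k + 1 : ℕ) : ℝ≥0∞) * F ((x, y), false)) = q ^ rowSize k x * (q ^ y * (α * F ((x, y), true))
        + q ^ y * (((k + 1 : ℕ) : ℝ≥0∞) * F ((x, y), false))) := by
      intro y
      simp only [rowSize, pow_add]
      ring
    rw [tsum_congr e2, ENNReal.tsum_mul_left]
    congr 1
    have e3 : ∀ y : ℕ, q ^ y * (α * F (rowFeed (x, true) y) + k * F ((x, y), false) +
        F ((x, y + 1), true)) = q ^ y * (α * F (rowFeed (x, true) y)) +
        (q ^ y * (k * F ((x, y), false)) + q ^ y * F ((x, y + 1), true)) := by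
      intro y; ring
    have e4 : ∑' y : ℕ, q ^ y * (α * F (rowFeed (x, true) y)) =
        α * F ((x, 0), true) + ∑' y : ℕ, q ^ y * F ((x, y), false) := by
      rw [tsum_eq_zero_add' ENNReal.summable]
      congr 1
      · simp [rowFeed]
      · refine tsum_congr fun y => ?_
        have : rowFeed (x, true) (y + 1) = ((x, y), false) := by
          simp [rowFeed]; rfl
        rw [this, pow_succ, mul_assoc, ← mul_assoc q, mul_comm q, hq, one_mul]
        rfl
    have e5 : ∑' y : ℕ, q ^ y * (α * F ((x, y), true)) =
        α * F ((x, 0), true) + ∑' y : ℕ, q ^ y * F ((x, y + 1), true) := by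
      rw [tsum_eq_zero_add' ENNReal.summable]
      congr 1
      · simp
      · refine tsum_congr fun y => ?_
        rw [pow_succ, mul_assoc, ← mul_assoc q, mul_comm q, hq, one_mul]
    rw [tsum_congr e3, ENNReal.tsum_add, ENNReal.tsum_add, ENNReal.tsum_add, e4, e5]
    have e6 : ∑' y : ℕ, q ^ y * (((k + 1 : ℕ) : ℝ≥0∞) * F ((x, y), false)) =
        ∑' y : ℕ, q ^ y * F ((x, y), false) + ∑' y : ℕ, q ^ y * (k * F ((x, y), false)) := by
      rw [← ENNReal.tsum_add]
      refine tsum_congr fun y => ?_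
      push_cast
      ring
    rw [e6]
    ring

theorem foldl_levelStep_le (c : ℕ) (w : List ℕ) (l l' : ℕ → ℕ) (h : ∀ b, l b ≤ l' b + c) (b : ℕ) :
    w.foldl levelStep l b ≤ w.foldl levelStep l' b + c := by
  induction w generalizing l l' with
  | nil => exact h b
  | cons a w ih =>
    refine ih _ _ fun b => ?_
    have h1 := h a
    have h2 := h b
    unfold levelStep
    split_ifs <;> omega

theorem runWord_levelStep_le (c : ℕ) {k n : ℕ} (u : Fin n → Fin k) (l l' : ℕ → ℕ)
    (h : ∀ b, l b ≤ l' b + c) (b : ℕ) :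
    runWord levelStep l u b ≤ runWord levelStep l' u b + c :=
  foldl_levelStep_le c _ l l' h b

open scoped ENNReal in
theorem tsum_rowState_mass (q : ℝ≥0∞) (k : ℕ) :
    ∑' x, q ^ rowSize k x = (∑' y : ℕ, q ^ y) ^ k := by
  induction k with
  | zero => exact (tsum_fintype (L := .unconditional Unit) fun _ : Unit => q ^ 0).trans (by simp)
  | succ k ih =>
    refine (ENNReal.tsum_prod' (f := fun x : RowState k × ℕ => q ^ rowSize (k + 1) x)).trans ?_
    simp only [rowSize, pow_add, ENNReal.tsum_mul_left, ENNReal.tsum_mul_right, ih, pow_one]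

open scoped ENNReal in
theorem tsum_rowState_size (q β : ℝ≥0∞) (hβ : ∑' y : ℕ, q ^ y * y = β * ∑' y : ℕ, q ^ y)
    (k : ℕ) :
    ∑' x, q ^ rowSize k x * rowSize k x = k * β * (∑' y : ℕ, q ^ y) ^ k := by
  induction k with
  | zero => simp [rowSize]
  | succ k ih =>
    refine (ENNReal.tsum_prod' (f := fun x : RowState k × ℕ =>
      q ^ rowSize (k + 1) x * rowSize (k + 1) x)).trans ?_
    have e : ∀ (x : RowState k) (y : ℕ), q ^ rowSize (k + 1) (x, y) * rowSize (k + 1) (x, y) =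
        q ^ rowSize k x * rowSize k x * q ^ y + q ^ rowSize k x * (q ^ y * y) := by
      intro x y
      simp only [rowSize, pow_add]
      push_cast
      ring
    simp only [e, ENNReal.tsum_add, ENNReal.tsum_mul_left, ENNReal.tsum_mul_right, ih, hβ,
      tsum_rowState_mass]
    push_cast
    ring

open scoped ENNReal in
theorem tsum_geometric_mul_coe {q : ℝ} (h0 : 0 ≤ q) (h1 : q < 1) :
    ∑' y : ℕ, ENNReal.ofReal q ^ y * y =
      ENNReal.ofReal (q / (1 - q)) * ∑' y : ℕ, ENNReal.ofReal q ^ y := by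
  have hn : ‖q‖ < 1 := by rwa [Real.norm_of_nonneg h0]
  have e1 : ∑' y : ℕ, ENNReal.ofReal q ^ y * y = ENNReal.ofReal (q / (1 - q) ^ 2) := by
    rw [← tsum_coe_mul_geometric_of_norm_lt_one hn, ENNReal.ofReal_tsum_of_nonneg
      (fun y => by positivity) (hasSum_coe_mul_geometric_of_norm_lt_one hn).summable]
    refine tsum_congr fun y => ?_
    rw [ENNReal.ofReal_mul (by positivity), ENNReal.ofReal_pow h0, ENNReal.ofReal_natCast, mul_comm]
  have e2 : ∑' y : ℕ, ENNReal.ofReal q ^ y = ENNReal.ofReal ((1 - q)⁻¹) := by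
    rw [← tsum_geometric_of_lt_one h0 h1, ENNReal.ofReal_tsum_of_nonneg
      (fun y => by positivity) (summable_geometric_of_lt_one h0 h1)]
    exact tsum_congr fun y => (ENNReal.ofReal_pow h0 y).symm
  have : 0 < 1 - q := by linarith
  rw [e1, e2, ← ENNReal.ofReal_mul (by positivity)]
  congr 1
  field_simp

/-- The sum over all words of length `n` of the last level reached from `l`. -/
def levelSum (k n : ℕ) (l : ℕ → ℕ) : ℕ := ∑ u : Fin n → Fin k, runWord levelStep l u (k - 1)

open scoped ENNReal in
theorem tsum_levelSum_le (α q : ℝ≥0∞) (hα : α ≠ ∞) (hq : α * q = 1) (k : ℕ) (hk : 1 ≤ k)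
    (hZ : ∑' x, q ^ rowSize k x ≠ ∞) (hP : ∑' x, q ^ rowSize k x * rowSize k x ≠ ∞) (n : ℕ) :
    ∑' x, q ^ rowSize k x * levelSum k n (rowLevel k x) ≤
      k ^ n * (∑' x, q ^ rowSize k x * rowSize k x + n * (α / k) * ∑' x, q ^ rowSize k x) ∧
    ∑' x, q ^ rowSize k x * levelSum k n (rowLevel k x) ≠ ∞ := by
  have hk0 : (k : ℝ≥0∞) ≠ 0 := by exact_mod_cast (by omega : k ≠ 0)
  induction n with
  | zero =>
    have e : ∀ x, (levelSum k 0 (rowLevel k x)) = rowSize k x := fun x => by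
      simp [levelSum, runWord_zero, rowLevel_eq_rowSize k x (k - 1) (by omega)]
    simp [e, hP]
  | succ n ih =>
    obtain ⟨ih, hfin⟩ := ih
    set Z := ∑' x, q ^ rowSize k x
    set P := ∑' x, q ^ rowSize k x * levelSum k n (rowLevel k x)
    have hst := tsum_rowState_stationary α q hq k fun r => (levelSum k n (rowLevel k r.1) : ℝ≥0∞)
    have e1 : ∀ x, ∑ a ∈ Finset.range k, (levelSum k n (rowLevel k (rowStep k x a).1) : ℝ≥0∞) =
        levelSum k (n + 1) (rowLevel k x) := by
      intro x
      rw [levelSum, sum_runWord_cons levelStep _ k n fun l => l (k - 1), Nat.cast_sum]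
      refine Finset.sum_congr rfl fun a ha => ?_
      rw [funext (rowStep_spec k x a (Finset.mem_range.1 ha)).1, levelSum]
    have e2 : ∀ x, levelSum k n (rowLevel k x) ≤
        levelSum k n (rowLevel k (rowZero k x).1) + k ^ n := by
      intro x
      have : k ^ n = ∑ _u : Fin n → Fin k, 1 := by simp
      rw [levelSum, levelSum, this, ← Finset.sum_add_distrib]
      refine Finset.sum_le_sum fun u _ => runWord_levelStep_le 1 u _ _ (fun b => ?_) _
      rw [(rowZero_spec k x).1 b]
      omega
    simp only [e1, mul_add, ENNReal.tsum_add] at hst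
    have hr : ∑' x, q ^ rowSize k x * (α * (levelSum k n (rowLevel k x) : ℝ≥0∞)) = α * P := by
      rw [← ENNReal.tsum_mul_left]; exact tsum_congr fun x => by ring
    have hr' : ∑' x, q ^ rowSize k x * (k * (levelSum k n (rowLevel k x) : ℝ≥0∞)) = k * P := by
      rw [← ENNReal.tsum_mul_left]; exact tsum_congr fun x => by ring
    rw [hr, hr'] at hst
    set P' := ∑' x, q ^ rowSize k x * (levelSum k (n + 1) (rowLevel k x) : ℝ≥0∞)
    set A := ∑' x, q ^ rowSize k x * (α * (levelSum k n (rowLevel k (rowZero k x).1) : ℝ≥0∞))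
    have h2 : α * P ≤ A + α * (k ^ n * Z) := by
      rw [← hr, ← ENNReal.tsum_mul_left, ← ENNReal.tsum_mul_left, ← ENNReal.tsum_add]
      refine ENNReal.tsum_le_tsum fun x => ?_
      have : (levelSum k n (rowLevel k x) : ℝ≥0∞) ≤
        levelSum k n (rowLevel k (rowZero k x).1) + k ^ n := by exact_mod_cast e2 x
      calc _ ≤ q ^ rowSize k x * (α * (levelSum k n (rowLevel k (rowZero k x).1) + k ^ n)) := by
            gcongr
        _ = _ := by ring
    have hαP : α * P ≠ ∞ := ENNReal.mul_ne_top hα hfin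
    have h3 : P' ≤ k * P + α * (k ^ n * Z) := by
      refine (ENNReal.add_le_add_iff_left hαP).1 ?_
      calc α * P + P' ≤ A + α * (k ^ n * Z) + P' := by gcongr
        _ = (A + P') + α * (k ^ n * Z) := by ring
        _ = _ := by rw [hst]; ring
    have hkn : (k : ℝ≥0∞) ^ n ≠ ∞ := ENNReal.pow_ne_top (ENNReal.natCast_ne_top k)
    refine ⟨h3.trans ?_, ne_top_of_le_ne_top (ENNReal.add_ne_top.2
      ⟨ENNReal.mul_ne_top (ENNReal.natCast_ne_top k) hfin,
        ENNReal.mul_ne_top hα (ENNReal.mul_ne_top hkn hZ)⟩) h3⟩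
    have hαk : α = k * (α / k) :=
      (ENNReal.mul_div_cancel hk0 (ENNReal.natCast_ne_top k)).symm
    calc k * P + α * (k ^ n * Z)
        ≤ k * (k ^ n * (∑' x, q ^ rowSize k x * rowSize k x + n * (α / k) * Z)) +
          k * (α / k) * (k ^ n * Z) := by rw [← hαk]; gcongr
      _ = _ := by push_cast; ring

theorem levelSum_zero_le (k : ℕ) (hk : 1 ≤ k) (n : ℕ) (β : ℝ) (hβ : 0 < β) :
    (levelSum k n fun _ => 0 : ℝ) ≤ k ^ n * (k / β + n * (1 + β) / k) := by
  have hα : 0 < 1 + β := by positivity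
  set q : ℝ := (1 + β)⁻¹ with hq
  have hq0 : 0 ≤ q := by positivity
  have hq1 : q < 1 := inv_lt_one_of_one_lt₀ (by linarith)
  have hqβ : q / (1 - q) = 1 / β := by
    have : 1 - (1 + β)⁻¹ = β / (1 + β) := by field_simp; ring
    rw [hq, this]
    field_simp
  set Q := ENNReal.ofReal q
  have hS : ∑' y : ℕ, Q ^ y ≠ ⊤ := by
    rw [ENNReal.tsum_geometric]
    refine ENNReal.inv_ne_top.2 (tsub_pos_of_lt ?_).ne'
    rw [← ENNReal.ofReal_one]
    exact (ENNReal.ofReal_lt_ofReal_iff one_pos).2 hq1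
  have hS1 : 1 ≤ ∑' y : ℕ, Q ^ y := by
    exact (pow_zero Q).symm.le.trans (ENNReal.le_tsum (f := fun y : ℕ => Q ^ y) 0)
  have hm := tsum_rowState_mass Q k
  have hs := tsum_rowState_size Q _ (tsum_geometric_mul_coe hq0 hq1) k
  rw [hqβ] at hs
  set Z := (∑' y : ℕ, Q ^ y) ^ k with hZ
  have hZt : Z ≠ ⊤ := ENNReal.pow_ne_top hS
  have hZ0 : Z ≠ 0 := (lt_of_lt_of_le one_pos (one_le_pow₀ hS1)).ne'
  have h := (tsum_levelSum_le (ENNReal.ofReal (1 + β)) Q ENNReal.ofReal_ne_top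
    (by rw [← ENNReal.ofReal_mul hα.le, hq, mul_inv_cancel₀ hα.ne', ENNReal.ofReal_one]) k hk
    (by rw [hm]; exact hZt)
    (by rw [hs]; exact ENNReal.mul_ne_top (ENNReal.mul_ne_top (ENNReal.natCast_ne_top k)
          ENNReal.ofReal_ne_top) hZt) n).1
  have h0 : levelSum k n (fun _ => 0) * Z ≤
      ∑' x, Q ^ rowSize k x * levelSum k n (rowLevel k x) := by
    rw [← hm, mul_comm, ← ENNReal.tsum_mul_right]
    refine ENNReal.tsum_le_tsum fun x => ?_
    gcongr
    exact Finset.sum_le_sum fun u _ => runWord_levelStep_le 0 u _ _ (by simp) _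
  rw [hs, hm] at h
  have hk0 : (0 : ℝ) < k := by exact_mod_cast hk
  have h1 : (levelSum k n (fun _ => 0) : ENNReal) * Z ≤
      ENNReal.ofReal (k ^ n * (k / β + n * (1 + β) / k)) * Z := by
    refine (h0.trans h).trans (le_of_eq ?_)
    rw [← add_mul, ← mul_assoc]
    congr 1
    rw [ENNReal.ofReal_mul (by positivity), ENNReal.ofReal_pow hk0.le, ENNReal.ofReal_natCast,
      ENNReal.ofReal_add (p := k / β) (by positivity) (by positivity), mul_div_assoc (n : ℝ),
      ENNReal.ofReal_mul (p := n) (by positivity), ENNReal.ofReal_div_of_pos hk0,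
      ENNReal.ofReal_natCast, ENNReal.ofReal_natCast, div_eq_mul_one_div (k : ℝ) β,
      ENNReal.ofReal_mul hk0.le, ENNReal.ofReal_natCast]
  have h2 := (ENNReal.mul_le_mul_iff_left hZ0 hZt).1 h1
  rw [← ENNReal.ofReal_natCast] at h2
  exact (ENNReal.ofReal_le_ofReal_iff (by positivity)).1 h2

theorem expLNDS_eq_levelSum (k n : ℕ) (hk : 1 ≤ k) :
    expLNDS k n = levelSum k n (fun _ => 0) / (k : ℝ) ^ n := by
  obtain ⟨k, rfl⟩ := Nat.exists_eq_add_of_le' hk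
  simp only [expLNDS, levelSum, LNDS_ofFn, Nat.add_sub_cancel]
  push_cast
  rfl

theorem expLNDS_le (k n : ℕ) (hk : 1 ≤ k) (hn : 1 ≤ n) :
    expLNDS k n ≤ n / k + 2 * Real.sqrt n := by
  have hk0 : (0 : ℝ) < k := by exact_mod_cast hk
  have hn0 : (0 : ℝ) < n := by exact_mod_cast hn
  have hs : 0 < Real.sqrt n := Real.sqrt_pos.2 hn0
  have h := levelSum_zero_le k hk n (k / Real.sqrt n) (by positivity)
  rw [expLNDS_eq_levelSum k n hk, div_le_iff₀ (by positivity), mul_comm _ ((k : ℝ) ^ n)]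
  refine h.trans (le_of_eq ?_)
  congr 1
  have h2 : Real.sqrt n * Real.sqrt n = n := Real.mul_self_sqrt hn0.le
  field_simp
  nlinarith


/-- Gelfand–Tsetlin patterns with `k` rows, without the interlacing condition. -/
def GTPat : ℕ → Type
  | 0 => Unit
  | k + 1 => GTPat k × (ℕ → ℕ)

/-- Append a row to a pattern. -/
def gtCons {k : ℕ} (p : GTPat k) (l : ℕ → ℕ) : GTPat (k + 1) := (p, l)

theorem exists_eq_gtCons {k : ℕ} (p : GTPat (k + 1)) : ∃ q l, p = gtCons q l := ⟨p.1, p.2, rfl⟩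

/-- The last row of a pattern. -/
def gtTop : (k : ℕ) → GTPat k → ℕ → ℕ
  | 0, _ => fun _ => 0
  | _ + 1, p => p.2

/-- Interlacing of two rows. -/
def Interlace (μ l : ℕ → ℕ) : Prop := ∀ i, l (i + 1) ≤ μ i ∧ μ i ≤ l i

/-- Consecutive rows interlace. -/
def GTValid : (k : ℕ) → GTPat k → Prop
  | 0, _ => True
  | k + 1, p => GTValid k p.1 ∧ Interlace (gtTop k p.1) p.2

/-- Add a box to row `i`. -/
def incr (i : ℕ) (l : ℕ → ℕ) : ℕ → ℕ := Function.update l i (l i + 1)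

/-- Remove a box from row `i`. -/
def decr (i : ℕ) (l : ℕ → ℕ) : ℕ → ℕ := Function.update l i (l i - 1)

/-- The row of `l` receiving a box when row `i` of the preceding row `μ` receives one. -/
def bumpIndex (μ l : ℕ → ℕ) (i : ℕ) : ℕ := if l i = μ i then i else i + 1

/-- Insertion of the letter `a`, with the index of the row to which a box is added. -/
def gtStep : (k : ℕ) → GTPat k → ℕ → GTPat k × ℕ
  | 0, p, _ => (p, 0)
  | k + 1, (p, l), a =>
    if a = k then (gtCons p (incr 0 l), 0)
    else (gtCons (gtStep k p a).1 (incr (bumpIndex (gtTop k p) l (gtStep k p a).2) l),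
      bumpIndex (gtTop k p) l (gtStep k p a).2)

theorem gtStep_last (k : ℕ) (p : GTPat k) (l : ℕ → ℕ) :
    gtStep (k + 1) (gtCons p l) k = (gtCons p (incr 0 l), 0) := by
  simp [gtCons, gtStep]

theorem gtStep_of_ne (k : ℕ) (p : GTPat k) (l : ℕ → ℕ) (a : ℕ) (ha : a ≠ k) :
    gtStep (k + 1) (gtCons p l) a =
      (gtCons (gtStep k p a).1 (incr (bumpIndex (gtTop k p) l (gtStep k p a).2) l),
        bumpIndex (gtTop k p) l (gtStep k p a).2) := by
  simp [gtCons, gtStep, ha]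

theorem incr_apply (i : ℕ) (l : ℕ → ℕ) (j : ℕ) : incr i l j = if j = i then l i + 1 else l j := by
  simp [incr, Function.update_apply]

theorem decr_apply (i : ℕ) (l : ℕ → ℕ) (j : ℕ) : decr i l j = if j = i then l i - 1 else l j := by
  simp [decr, Function.update_apply]

theorem decr_incr (i : ℕ) (l : ℕ → ℕ) : decr i (incr i l) = l := by
  ext j; simp only [incr_apply, decr_apply]; split_ifs with h <;> simp [h]

theorem incr_decr (i : ℕ) (l : ℕ → ℕ) (h : 0 < l i) : incr i (decr i l) = l := by
  ext j; simp only [incr_apply, decr_apply]; split_ifs with h <;> simp [h]; omega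

theorem incr_injective (i : ℕ) : Function.Injective (incr i) :=
  Function.LeftInverse.injective (decr_incr i)

theorem Interlace.antitone {μ l : ℕ → ℕ} (h : Interlace μ l) : Antitone l :=
  antitone_nat_of_succ_le fun i => (h i).1.trans (h i).2

theorem GTValid.antitone {k : ℕ} {p : GTPat k} (h : GTValid k p) : Antitone (gtTop k p) := by
  cases k with
  | zero => exact fun _ _ _ => le_rfl
  | succ k => exact h.2.antitone

theorem gtStep_valid (k : ℕ) (p : GTPat k) (hp : GTValid k p) (a : ℕ) (ha : a < k) :
    GTValid k (gtStep k p a).1 ∧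
      gtTop k (gtStep k p a).1 = incr (gtStep k p a).2 (gtTop k p) := by
  induction k with
  | zero => omega
  | succ k ih =>
    obtain ⟨p, l, rfl⟩ := exists_eq_gtCons p
    obtain ⟨hp, hl⟩ : GTValid k p ∧ Interlace (gtTop k p) l := hp
    by_cases hak : a = k
    · rw [hak, gtStep_last]
      refine ⟨⟨hp, ?_⟩, rfl⟩
      change Interlace (gtTop k p) (incr 0 l)
      intro i
      have := hl i
      simp only [incr_apply]
      grind
    · obtain ⟨h1, h2⟩ := ih p hp (by omega)
      rw [gtStep_of_ne _ _ _ _ hak]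
      refine ⟨⟨h1, ?_⟩, rfl⟩
      change Interlace (gtTop k (gtStep k p a).1) (incr _ l)
      intro j
      have hanti := h1.antitone
      rw [h2] at hanti ⊢
      generalize (gtStep k p a).2 = i at *
      generalize gtTop k p = μ at *
      have e1 := hl j
      have e2 := hl i
      have e3 := hanti (Nat.le_succ j)
      simp only [incr_apply, bumpIndex] at e3 ⊢
      split_ifs at e3 ⊢ <;> subst_vars <;> omega

/-- The first entries of the rows of a pattern. -/
def gtLevel : (k : ℕ) → GTPat k → ℕ → ℕ
  | 0, _, _ => 0
  | k + 1, p, b => if b < k then gtLevel k p.1 b else p.2 0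

theorem gtLevel_eq_top (k : ℕ) (p : GTPat k) (b : ℕ) (hb : k ≤ b + 1) :
    gtLevel k p b = gtTop k p 0 := by
  cases k with
  | zero => rfl
  | succ k => simp [gtLevel, gtTop, show ¬ b < k by omega]

theorem gtLevel_step (k : ℕ) (p : GTPat k) (hp : GTValid k p) (a : ℕ) (ha : a < k) (b : ℕ) :
    gtLevel k (gtStep k p a).1 b = levelStep (gtLevel k p) a b := by
  induction k generalizing b with
  | zero => omega
  | succ k ih =>
    obtain ⟨p, l, rfl⟩ := exists_eq_gtCons p
    obtain ⟨hp, hl⟩ : GTValid k p ∧ Interlace (gtTop k p) l := hp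
    by_cases hak : a = k
    · rw [hak, gtStep_last]
      simp only [gtLevel, gtCons, levelStep, lt_irrefl, if_false, incr_apply]
      split_ifs <;> omega
    · have h1 := ih p hp (by omega)
      have hk1 := h1 (k - 1)
      have h2 := (gtStep_valid k p hp a (by omega)).2
      have h3 := hl 0
      rw [gtLevel_eq_top _ _ _ (by omega), h2] at hk1
      simp only [levelStep, gtLevel_eq_top k p (k - 1) (by omega), incr_apply,
        show ¬ k - 1 < a by omega, if_false] at hk1
      rw [gtStep_of_ne _ _ _ _ hak]
      simp only [gtLevel, gtCons, levelStep, show a < k by omega, if_true, h1, incr_apply]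
      by_cases hb : b < k
      · simp only [hb, if_true]
      · simp only [hb, if_false, show ¬ b < a by omega]
        by_cases h4 : (gtStep k p a).2 = 0
        · rw [h4] at hk1 ⊢
          rw [if_pos rfl] at hk1
          by_cases h5 : l 0 = gtTop k p 0
          · rw [bumpIndex, if_pos h5, if_pos rfl]
            omega
          · rw [bumpIndex, if_neg h5, if_neg (by omega)]
            omega
        · rw [if_neg (Ne.symm h4)] at hk1
          have h5 : 0 ≠ bumpIndex (gtTop k p) l (gtStep k p a).2 := by
            unfold bumpIndex
            split_ifs with h6
            · exact Ne.symm h4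
            · exact (Nat.succ_ne_zero _).symm
          rw [if_neg h5]
          omega


open Classical in
/-- The value `x` if `P` holds, and `0` otherwise. -/
noncomputable def guardBy (P : Prop) (x : ENNReal) : ENNReal := if P then x else 0

theorem guardBy_pos {P : Prop} (h : P) (x : ENNReal) : guardBy P x = x := if_pos h

theorem guardBy_neg {P : Prop} (h : ¬ P) (x : ENNReal) : guardBy P x = 0 := if_neg h

theorem guardBy_zero (P : Prop) : guardBy P 0 = 0 := by unfold guardBy; split_ifs <;> rfl

theorem guardBy_and (P Q : Prop) (x : ENNReal) : guardBy (P ∧ Q) x = guardBy P (guardBy Q x) := by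
  by_cases hP : P <;> by_cases hQ : Q <;> simp [guardBy, hP, hQ]

theorem guardBy_add (P : Prop) (x y : ENNReal) :
    guardBy P (x + y) = guardBy P x + guardBy P y := by
  by_cases hP : P <;> simp [guardBy, hP]

theorem guardBy_mul (P : Prop) (x y : ENNReal) : guardBy P (x * y) = x * guardBy P y := by
  by_cases hP : P <;> simp [guardBy, hP]

theorem guardBy_tsum {ι : Type*} (P : Prop) (f : ι → ENNReal) :
    guardBy P (∑' i, f i) = ∑' i, guardBy P (f i) := by
  by_cases hP : P <;> simp [guardBy, hP]

theorem tsum_guardBy_comp {α β : Type*} {e : α → β} (he : Function.Injective e) {P : α → Prop}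
    {Q : β → Prop} (h : ∀ a, P a ↔ Q (e a)) (hr : ∀ b, Q b → b ∈ Set.range e)
    (f : β → ENNReal) : ∑' a, guardBy (P a) (f (e a)) = ∑' b, guardBy (Q b) (f b) := by
  rw [← he.tsum_eq (f := fun b => guardBy (Q b) (f b))]
  · exact tsum_congr fun a => by rw [h]
  · intro b hb
    by_contra h'
    exact hb (guardBy_neg (fun hq => h' (hr b hq)) _)

theorem tsum_interlace_step (μ : ℕ → ℕ) (hμ : Antitone μ) (f : (ℕ → ℕ) → ℕ → ENNReal) :
    ∑' l, (guardBy (Interlace μ l) (f (incr 0 l) 0) + ∑' i, guardBy (μ (i + 1) < μ i)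
      (guardBy (Interlace (decr i μ) l)
        (f (incr (bumpIndex (decr i μ) l i) l) (bumpIndex (decr i μ) l i)))) =
      ∑' l, guardBy (Interlace μ l) (∑' i, guardBy (l (i + 1) < l i) (f l i)) := by
  have eL : ∀ l i, guardBy (μ (i + 1) < μ i) (guardBy (Interlace (decr i μ) l)
        (f (incr (bumpIndex (decr i μ) l i) l) (bumpIndex (decr i μ) l i))) =
      guardBy (μ (i + 1) < μ i ∧ Interlace (decr i μ) l ∧ l i = μ i - 1) (f (incr i l) i) +
      guardBy (μ (i + 1) < μ i ∧ Interlace (decr i μ) l ∧ l i ≠ μ i - 1)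
        (f (incr (i + 1) l) (i + 1)) := by
    intro l i
    have hd : decr i μ i = μ i - 1 := by simp [decr_apply]
    by_cases h : l i = μ i - 1
    · simp [bumpIndex, hd, h, guardBy_and, guardBy_neg]
    · simp [bumpIndex, hd, h, guardBy_and, guardBy_neg]
  have eR : ∀ l i, guardBy (Interlace μ l) (guardBy (l (i + 1) < l i) (f l i)) =
      guardBy (Interlace μ l ∧ l (i + 1) < l i ∧ l i = μ i) (f l i) +
      guardBy (Interlace μ l ∧ l (i + 1) < l i ∧ l i ≠ μ i) (f l i) := by
    intro l i
    by_cases h : l i = μ i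
    · simp [h, guardBy_and, guardBy_neg]
    · simp [h, guardBy_and, guardBy_neg]
  simp only [guardBy_tsum, eL, eR, ENNReal.tsum_add]
  have e0 : ∑' l, guardBy (Interlace μ l) (f (incr 0 l) 0) =
      ∑' l, guardBy (Interlace μ l ∧ l (0 + 1) < l 0 ∧ l 0 ≠ μ 0) (f l 0) := by
    refine tsum_guardBy_comp (incr_injective 0) (fun l => ?_) (fun l h => ?_) fun l => f l 0
    · simp only [Interlace, incr_apply]
      constructor
      · intro h
        refine ⟨fun i => ?_, ?_, ?_⟩
        · grind
        · grind
        · grind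
      · rintro ⟨h, h1, h2⟩ i
        grind
    · have := h.1 0
      exact ⟨_, incr_decr 0 l (by omega)⟩
  have eA : ∀ i, ∑' l, guardBy (μ (i + 1) < μ i ∧ Interlace (decr i μ) l ∧ l i = μ i - 1)
      (f (incr i l) i) = ∑' l, guardBy (Interlace μ l ∧ l (i + 1) < l i ∧ l i = μ i) (f l i) := by
    intro i
    refine tsum_guardBy_comp (incr_injective i) (fun l => ?_) (fun l h => ?_) fun l => f l i
    · simp only [Interlace, incr_apply, decr_apply]
      constructor
      · rintro ⟨h1, h2, h3⟩
        refine ⟨fun j => ?_, ?_, ?_⟩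
        · have := h2 j
          have : μ (j + 1) ≤ μ j := hμ (Nat.le_succ j)
          grind
        · have := h2 i
          simp only [if_true] at this ⊢
          split_ifs <;> omega
        · simp only [if_true]; omega
      · rintro ⟨h1, h2, h3⟩
        simp only [if_true] at h2 h3
        have h4 := h1 i
        have h5 := h1 (i + 1)
        refine ⟨?_, fun j => ?_, by omega⟩
        · grind
        · have := h1 j
          split_ifs at * <;> subst_vars <;> omega
    · exact ⟨_, incr_decr i l (by omega)⟩
  have eB : ∀ i, ∑' l, guardBy (μ (i + 1) < μ i ∧ Interlace (decr i μ) l ∧ l i ≠ μ i - 1)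
      (f (incr (i + 1) l) (i + 1)) =
      ∑' l, guardBy (Interlace μ l ∧ l (i + 1 + 1) < l (i + 1) ∧ l (i + 1) ≠ μ (i + 1))
        (f l (i + 1)) := by
    intro i
    refine tsum_guardBy_comp (incr_injective (i + 1)) (fun l => ?_) (fun l h => ?_)
      fun l => f l (i + 1)
    · simp only [Interlace, incr_apply, decr_apply]
      constructor
      · rintro ⟨h1, h2, h3⟩
        have h4 := h2 i
        have h5 := h2 (i + 1)
        simp only [if_true] at h4
        rw [if_neg (by omega)] at h5
        refine ⟨fun j => ?_, ?_, ?_⟩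
        · have := h2 j
          split_ifs at * <;> subst_vars <;> omega
        · simp only [if_true]
          split_ifs <;> omega
        · simp only [if_true]; omega
      · rintro ⟨h1, h2, h3⟩
        simp only [if_true] at h2 h3
        have h4 := h1 i
        have h5 := h1 (i + 1)
        simp only [if_true] at h4 h5
        refine ⟨by split_ifs at * <;> omega, fun j => ?_, by split_ifs at * <;> omega⟩
        have := h1 j
        split_ifs at * <;> subst_vars <;> omega
    · exact ⟨_, incr_decr (i + 1) l (by omega)⟩
  rw [e0, ENNReal.tsum_comm, ENNReal.tsum_comm (f := fun l i => guardBy (μ (i + 1) < μ i ∧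
      Interlace (decr i μ) l ∧ l i ≠ μ i - 1) _),
    ENNReal.tsum_comm (f := fun l i => guardBy (Interlace μ l ∧ l (i + 1) < l i ∧ l i = μ i) _),
    ENNReal.tsum_comm (f := fun l i => guardBy (Interlace μ l ∧ l (i + 1) < l i ∧ l i ≠ μ i) _),
    tsum_congr eA, tsum_congr eB, tsum_eq_zero_add' (f := fun i => ∑' l, guardBy (Interlace μ l ∧
      l (i + 1) < l i ∧ l i ≠ μ i) (f l i)) ENNReal.summable]
  ring


theorem tsum_gtPat_succ (k : ℕ) (G : GTPat (k + 1) → ENNReal) :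
    ∑' p, G p = ∑' (l : ℕ → ℕ) (p : GTPat k), G (gtCons p l) := by
  rw [ENNReal.tsum_comm]
  exact ENNReal.tsum_prod' (f := G)

theorem tsum_gtStep (k : ℕ) (F : GTPat k × ℕ → ENNReal) :
    ∑' p, guardBy (GTValid k p) (∑ a ∈ Finset.range k, F (gtStep k p a)) =
      ∑' p, guardBy (GTValid k p)
        (∑' i, guardBy (gtTop k p (i + 1) < gtTop k p i) (F (p, i))) := by
  induction k with
  | zero => simp [guardBy, gtTop]
  | succ k ih =>
    rw [tsum_gtPat_succ, tsum_gtPat_succ]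
    have e1 : ∀ (l : ℕ → ℕ) (p : GTPat k), guardBy (GTValid (k + 1) (gtCons p l))
        (∑ a ∈ Finset.range (k + 1), F (gtStep (k + 1) (gtCons p l) a)) =
        guardBy (GTValid k p) (guardBy (Interlace (gtTop k p) l) (F ((gtCons p (incr 0 l)), 0))) +
        guardBy (GTValid k p) (∑ a ∈ Finset.range k,
          (fun x : GTPat k × ℕ => guardBy (Interlace (decr x.2 (gtTop k x.1)) l)
            (F (gtCons x.1 (incr (bumpIndex (decr x.2 (gtTop k x.1)) l x.2) l),
              bumpIndex (decr x.2 (gtTop k x.1)) l x.2))) (gtStep k p a)) := by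
      intro l p
      by_cases hp : GTValid k p
      · rw [guardBy_pos hp, guardBy_pos hp, Finset.sum_range_succ, gtStep_last, add_comm (∑ a ∈ _, _),
          show GTValid (k + 1) (gtCons p l) = (GTValid k p ∧ Interlace (gtTop k p) l) from rfl,
          guardBy_and, guardBy_pos hp, guardBy_add]
        congr 1
        by_cases hl : Interlace (gtTop k p) l
        · rw [guardBy_pos hl]
          refine Finset.sum_congr rfl fun a ha => ?_
          have ha := Finset.mem_range.1 ha
          simp only
          rw [(gtStep_valid k p hp a ha).2, decr_incr, guardBy_pos hl, gtStep_of_ne _ _ _ _ ha.ne]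
        · rw [guardBy_neg hl]
          refine (Finset.sum_eq_zero fun a ha => ?_).symm
          have ha := Finset.mem_range.1 ha
          simp only
          rw [(gtStep_valid k p hp a ha).2, decr_incr, guardBy_neg hl]
      · rw [guardBy_neg hp, guardBy_neg hp, guardBy_neg (fun h => hp h.1), add_zero]
    have e2 : ∀ (l : ℕ → ℕ) (p : GTPat k), guardBy (GTValid (k + 1) (gtCons p l))
        (∑' i, guardBy (gtTop (k + 1) (gtCons p l) (i + 1) < gtTop (k + 1) (gtCons p l) i) (F (gtCons p l, i))) =
        guardBy (GTValid k p) (guardBy (Interlace (gtTop k p) l)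
          (∑' i, guardBy (l (i + 1) < l i) (F (gtCons p l, i)))) := fun l p => guardBy_and _ _ _
    have e3 : ∀ l : ℕ → ℕ, ∑' p : GTPat k, guardBy (GTValid (k + 1) (gtCons p l))
        (∑ a ∈ Finset.range (k + 1), F (gtStep (k + 1) (gtCons p l) a)) =
        ∑' p, (guardBy (GTValid k p) (guardBy (Interlace (gtTop k p) l)
          (F (gtCons p (incr 0 l), 0))) +
        guardBy (GTValid k p) (∑' i, guardBy (gtTop k p (i + 1) < gtTop k p i)
          (guardBy (Interlace (decr i (gtTop k p)) l)
            (F (gtCons p (incr (bumpIndex (decr i (gtTop k p)) l i) l),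
              bumpIndex (decr i (gtTop k p)) l i))))) := by
      intro l
      rw [tsum_congr (e1 l), ENNReal.tsum_add, ENNReal.tsum_add]
      congr 1
      exact ih fun x => guardBy (Interlace (decr x.2 (gtTop k x.1)) l)
        (F (gtCons x.1 (incr (bumpIndex (decr x.2 (gtTop k x.1)) l x.2) l),
          bumpIndex (decr x.2 (gtTop k x.1)) l x.2))
    rw [tsum_congr e3, tsum_congr fun l => tsum_congr (e2 l), ENNReal.tsum_comm,
      ENNReal.tsum_comm (α := ℕ → ℕ)]
    refine tsum_congr fun p => ?_
    simp only [← guardBy_add, ← guardBy_tsum]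
    by_cases hp : GTValid k p
    · rw [guardBy_pos hp, guardBy_pos hp]
      exact tsum_interlace_step (gtTop k p) hp.antitone fun l i => F (gtCons p l, i)
    · rw [guardBy_neg hp, guardBy_neg hp]

/-- The pattern of zeros. -/
def gtZero : (k : ℕ) → GTPat k
  | 0 => ()
  | k + 1 => gtCons (gtZero k) fun _ => 0

theorem gtTop_gtZero (k : ℕ) : gtTop k (gtZero k) = fun _ => 0 := by
  cases k <;> rfl

theorem gtLevel_gtZero (k : ℕ) : gtLevel k (gtZero k) = fun _ => 0 := by
  induction k with
  | zero => rfl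
  | succ k ih => ext b; simp [gtLevel, gtZero, gtCons, ih]

theorem gtValid_and_top_eq_zero_iff (k : ℕ) (p : GTPat k) :
    (GTValid k p ∧ gtTop k p = fun _ => 0) ↔ p = gtZero k := by
  induction k with
  | zero => exact ⟨fun _ => rfl, fun _ => ⟨trivial, rfl⟩⟩
  | succ k ih =>
    obtain ⟨p, l, rfl⟩ := exists_eq_gtCons p
    constructor
    · rintro ⟨⟨h1, h2⟩, rfl : l = fun _ => 0⟩
      have : p = gtZero k := (ih p).1 ⟨h1, funext fun i => Nat.le_zero.1 (h2 i).2⟩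
      rw [this]
      rfl
    · intro h
      have h1 : p = gtZero k := congrArg Prod.fst h
      have h2 : l = fun _ => 0 := congrArg Prod.snd h
      subst h1 h2
      refine ⟨⟨((ih _).2 rfl).1, ?_⟩, rfl⟩
      change Interlace (gtTop k (gtZero k)) fun _ => 0
      rw [gtTop_gtZero]
      exact fun i => ⟨le_rfl, le_rfl⟩

/-- The number of chains of `n + 1` shapes from the empty one to `l`, each arising from the preceding
one by adding a box. -/
noncomputable def chainCount : ℕ → (ℕ → ℕ) → ENNReal
  | 0, l => guardBy (l = fun _ => 0) 1
  | n + 1, l => ∑' i, guardBy (l (i + 1) < l i) (chainCount n (decr i l))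

theorem sum_gtStep_eq (k : ℕ) (p : GTPat k) (hp : GTValid k p) (c : (ℕ → ℕ) → ENNReal)
    (G : GTPat k × ℕ → ENNReal) :
    c (gtTop k p) * ∑ a ∈ Finset.range k, G (gtStep k p a) = ∑ a ∈ Finset.range k,
      (fun x : GTPat k × ℕ => c (decr x.2 (gtTop k x.1)) * G x) (gtStep k p a) := by
  rw [Finset.mul_sum]
  refine Finset.sum_congr rfl fun a ha => ?_
  simp only [(gtStep_valid k p hp a (Finset.mem_range.1 ha)).2, decr_incr]

theorem sum_runWord_gtStep (k n : ℕ) (G : GTPat k → ENNReal) :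
    ∑ u : Fin n → Fin k, G (runWord (fun p a => (gtStep k p a).1) (gtZero k) u) =
      ∑' p, guardBy (GTValid k p) (chainCount n (gtTop k p) * G p) := by
  induction n generalizing G with
  | zero =>
    simp only [runWord_zero, Finset.univ_unique, Finset.sum_singleton, chainCount]
    rw [tsum_eq_single (gtZero k)]
    · obtain ⟨h1, h2⟩ := (gtValid_and_top_eq_zero_iff k _).2 rfl
      rw [guardBy_pos h1, guardBy_pos h2, one_mul]
    · intro p hp
      by_cases h1 : GTValid k p
      · rw [guardBy_neg (P := gtTop k p = fun _ => 0), zero_mul, guardBy_zero]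
        exact fun h2 => hp ((gtValid_and_top_eq_zero_iff k p).1 ⟨h1, h2⟩)
      · exact guardBy_neg h1 _
  | succ n ih =>
    rw [sum_runWord_snoc, ih fun p => ∑ a ∈ Finset.range k, G (gtStep k p a).1]
    have e : ∀ p, guardBy (GTValid k p) (chainCount n (gtTop k p) *
        ∑ a ∈ Finset.range k, G (gtStep k p a).1) = guardBy (GTValid k p)
        (∑ a ∈ Finset.range k, (fun x : GTPat k × ℕ =>
          chainCount n (decr x.2 (gtTop k x.1)) * G x.1) (gtStep k p a)) := by
      intro p
      by_cases hp : GTValid k p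
      · rw [sum_gtStep_eq k p hp _ fun x => G x.1]
      · rw [guardBy_neg hp, guardBy_neg hp]
    refine (tsum_congr e).trans ((tsum_gtStep k fun x : GTPat k × ℕ =>
      chainCount n (decr x.2 (gtTop k x.1)) * G x.1).trans ?_)
    refine tsum_congr fun p => ?_
    rw [chainCount, ← ENNReal.tsum_mul_right]
    simp only [mul_comm _ (G p), guardBy_mul]

/-- The number of patterns with a given last row. -/
noncomputable def patCount : ℕ → (ℕ → ℕ) → ENNReal
  | 0, l => guardBy (l = fun _ => 0) 1
  | k + 1, l => ∑' μ, guardBy (Interlace μ l) (patCount k μ)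

theorem tsum_gtPat_top (k : ℕ) (Ψ : (ℕ → ℕ) → ENNReal) :
    ∑' p, guardBy (GTValid k p) (Ψ (gtTop k p)) = ∑' l, patCount k l * Ψ l := by
  induction k generalizing Ψ with
  | zero =>
    rw [tsum_eq_single (fun _ => 0)]
    · refine (tsum_fintype (L := .unconditional Unit)
        fun _ : Unit => guardBy True (Ψ fun _ => 0)).trans ?_
      simp [patCount, guardBy_pos]
    · intro l hl
      rw [patCount, guardBy_neg hl, zero_mul]
  | succ k ih =>
    rw [tsum_gtPat_succ]
    refine tsum_congr fun l => ?_
    rw [patCount, ← ENNReal.tsum_mul_right]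
    have e : ∀ p : GTPat k, guardBy (GTValid (k + 1) (gtCons p l)) (Ψ (gtTop (k + 1) (gtCons p l))) =
      guardBy (GTValid k p) (guardBy (Interlace (gtTop k p) l) (Ψ l)) :=
      fun p => guardBy_and _ _ _
    rw [tsum_congr e, ih fun μ => guardBy (Interlace μ l) (Ψ l)]
    refine tsum_congr fun μ => ?_
    rw [mul_comm (guardBy _ _), ← guardBy_mul, ← guardBy_mul, mul_comm]

/-- The joint law of the last row and of the row to which a box is added. -/
theorem sum_sum_gtStep (k n : ℕ) (R : ℕ → (ℕ → ℕ) → ENNReal)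
    (hR : ∀ i l, guardBy (incr i l (i + 1) < incr i l i) (patCount k (incr i l)) =
      R i l * patCount k l)
    (H : (ℕ → ℕ) → ℕ → ENNReal) :
    ∑ u : Fin n → Fin k, ∑ a ∈ Finset.range k,
      H (gtTop k (runWord (fun p a => (gtStep k p a).1) (gtZero k) u))
        (gtStep k (runWord (fun p a => (gtStep k p a).1) (gtZero k) u) a).2 =
      ∑ u : Fin n → Fin k, ∑' i,
        R i (gtTop k (runWord (fun p a => (gtStep k p a).1) (gtZero k) u)) *
          H (gtTop k (runWord (fun p a => (gtStep k p a).1) (gtZero k) u)) i := by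
  rw [sum_runWord_gtStep k n fun p => ∑ a ∈ Finset.range k, H (gtTop k p) (gtStep k p a).2,
    sum_runWord_gtStep k n fun p => ∑' i, R i (gtTop k p) * H (gtTop k p) i]
  have e : ∀ p, guardBy (GTValid k p) (chainCount n (gtTop k p) *
      ∑ a ∈ Finset.range k, H (gtTop k p) (gtStep k p a).2) = guardBy (GTValid k p)
      (∑ a ∈ Finset.range k, (fun x : GTPat k × ℕ => chainCount n (decr x.2 (gtTop k x.1)) *
        H (decr x.2 (gtTop k x.1)) x.2) (gtStep k p a)) := by
    intro p
    by_cases hp : GTValid k p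
    · have := sum_gtStep_eq k p hp (fun l => chainCount n l) fun x =>
        H (decr x.2 (gtTop k x.1)) x.2
      rw [← this]
      congr 2
      refine Finset.sum_congr rfl fun a ha => ?_
      rw [(gtStep_valid k p hp a (Finset.mem_range.1 ha)).2, decr_incr]
    · rw [guardBy_neg hp, guardBy_neg hp]
  refine (tsum_congr e).trans ((tsum_gtStep k fun x : GTPat k × ℕ =>
    chainCount n (decr x.2 (gtTop k x.1)) * H (decr x.2 (gtTop k x.1)) x.2).trans ?_)
  rw [tsum_gtPat_top k fun l => ∑' i, guardBy (l (i + 1) < l i)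
      (chainCount n (decr i l) * H (decr i l) i),
    tsum_gtPat_top k fun l => chainCount n l * ∑' i, R i l * H l i]
  simp only [← ENNReal.tsum_mul_left]
  rw [ENNReal.tsum_comm, ENNReal.tsum_comm (α := ℕ → ℕ)]
  refine tsum_congr fun i => ?_
  have e2 : ∀ l, patCount k l * guardBy (l (i + 1) < l i)
      (chainCount n (decr i l) * H (decr i l) i) = guardBy (l (i + 1) < l i)
      (patCount k l * (chainCount n (decr i l) * H (decr i l) i)) := fun l => (guardBy_mul _ _ _).symm
  rw [tsum_congr e2, ← tsum_guardBy_comp (incr_injective i)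
    (P := fun l => incr i l (i + 1) < incr i l i) (fun l => Iff.rfl)
    (fun l hl => ⟨_, incr_decr i l (by omega)⟩)]
  refine tsum_congr fun l => ?_
  rw [decr_incr, mul_comm, guardBy_mul, hR]
  ring

/-- A partition with at most `k` parts, padded by zeros. -/
def IsRow (k : ℕ) (l : ℕ → ℕ) : Prop := Antitone l ∧ ∀ i, k ≤ i → l i = 0

/-- The shifted parts of a partition, as integers. -/
def shiftRow (k : ℕ) (l : ℕ → ℕ) (i : Fin k) : ℕ := l i + (k - 1 - i)

/-- The Vandermonde determinant in the shifted parts of a partition. -/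
noncomputable def rowVandermonde (k : ℕ) (l : ℕ → ℕ) : ℝ :=
  (Matrix.vandermonde fun i : Fin k => (shiftRow k l i : ℝ)).det

theorem det_descFactorial (k : ℕ) (x : Fin k → ℕ) :
    (Matrix.of fun i j : Fin k => ((x i).descFactorial j : ℝ)).det =
      (Matrix.vandermonde fun i => (x i : ℝ)).det := by
  rw [Matrix.det_eval_matrixOfPolynomials_eq_det_vandermonde (fun i => (x i : ℝ))
    (fun j => descPochhammer ℝ j) (fun j => descPochhammer_natDegree (R := ℝ) j)
    (fun j => monic_descPochhammer ℝ j)]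
  congr 1
  ext i j
  simp [descPochhammer_eval_eq_descFactorial]

theorem sum_descFactorial (a b s j : ℕ) (h : a ≤ b) :
    ∑ m ∈ Finset.Icc a b, ((m + s).descFactorial j : ℝ) =
      (((b + s + 1).descFactorial (j + 1) : ℝ) - (a + s).descFactorial (j + 1)) / (j + 1) := by
  have key : ∀ m : ℕ, (((m + 1).descFactorial (j + 1) : ℝ) - m.descFactorial (j + 1)) =
      (j + 1) * m.descFactorial j := by
    intro m
    rw [Nat.succ_descFactorial_succ, Nat.descFactorial_succ]
    by_cases hj : j ≤ m
    · push_cast [Nat.cast_sub hj]; ring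
    · rw [Nat.descFactorial_of_lt (not_le.1 hj)]; simp
  have hj : (j + 1 : ℝ) ≠ 0 := by positivity
  rw [eq_div_iff hj]
  induction b, h using Nat.le_induction with
  | base => rw [Finset.Icc_self, Finset.sum_singleton]; linarith [key (a + s)]
  | succ b hb ih =>
    rw [Finset.sum_Icc_succ_top (by omega), add_mul, ih]
    have := key (b + 1 + s)
    rw [show b + s + 1 = b + 1 + s by omega]
    linarith

theorem sum_rowVandermonde (k : ℕ) (l : ℕ → ℕ) (hl : Antitone l) :
    ∑ m ∈ Fintype.piFinset fun i : Fin k => Finset.Icc (l (i + 1)) (l i),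
      (Matrix.vandermonde fun i : Fin k => ((m i + (k - 1 - i) : ℕ) : ℝ)).det =
    (Matrix.of fun i j : Fin k => (((shiftRow (k + 1) l i.castSucc).descFactorial (j + 1) : ℝ) -
      (shiftRow (k + 1) l i.succ).descFactorial (j + 1)) / (j + 1)).det := by
  have h := MultilinearMap.map_sum_finset
    (Matrix.detRowAlternating (n := Fin k) (R := ℝ)).toMultilinearMap
    (fun (i : Fin k) (m : ℕ) (j : Fin k) => ((m + (k - 1 - i)).descFactorial j : ℝ))
    (fun i : Fin k => Finset.Icc (l (i + 1)) (l i))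
  have e : (fun i : Fin k => ∑ m ∈ Finset.Icc (l (i + 1)) (l i),
      fun j : Fin k => ((m + (k - 1 - i)).descFactorial j : ℝ)) =
      (Matrix.of fun i j : Fin k => (((shiftRow (k + 1) l i.castSucc).descFactorial (j + 1) : ℝ) -
      (shiftRow (k + 1) l i.succ).descFactorial (j + 1)) / (j + 1)) := by
    ext i j
    rw [Finset.sum_apply, sum_descFactorial _ _ _ _ (hl (Nat.le_succ _))]
    have h1 : l i + (k - 1 - i) + 1 = shiftRow (k + 1) l i.castSucc := by
      simp [shiftRow]; omega
    have h2 : l (i + 1) + (k - 1 - i) = shiftRow (k + 1) l i.succ := by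
      simp [shiftRow]; omega
    rw [h1, h2]
    rfl
  rw [e] at h
  refine Eq.trans ?_ h.symm
  refine Finset.sum_congr rfl fun m _ => ?_
  rw [← det_descFactorial]
  rfl

theorem rowVandermonde_succ (k : ℕ) (l : ℕ → ℕ) :
    rowVandermonde (k + 1) l = (∏ j : Fin k, (-((j : ℝ) + 1))) *
    (Matrix.of fun i j : Fin k => (((shiftRow (k + 1) l i.castSucc).descFactorial (j + 1) : ℝ) -
      (shiftRow (k + 1) l i.succ).descFactorial (j + 1)) / (j + 1)).det := by
  rw [rowVandermonde, ← det_descFactorial]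
  set A := (Matrix.of fun i j : Fin (k + 1) => ((shiftRow (k + 1) l i).descFactorial j : ℝ)) with hA
  rw [Matrix.det_eq_of_forall_row_eq_smul_add_pred (A := A)
    (B := Matrix.of fun i j => Fin.cases (A 0 j) (fun i' => A i'.succ j - A i'.castSucc j) i)
    (fun _ => 1) (fun j => rfl) (fun i j => by simp), Matrix.det_succ_column_zero,
    Fin.sum_univ_succ, Finset.sum_eq_zero]
  · rw [← Matrix.det_mul_row]
    simp only [hA]
    simp
    congr 1
    ext i j
    simp
    field_simp
    ring
  · intro i _
    simp [hA]

theorem patCount_eq (k : ℕ) : ∃ c : ℝ, ∀ l, (IsRow k l → 0 ≤ c * rowVandermonde k l) ∧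
    patCount k l = guardBy (IsRow k l) (ENNReal.ofReal (c * rowVandermonde k l)) := by
  induction k with
  | zero =>
    refine ⟨1, fun l => ⟨fun _ => by simp [rowVandermonde], ?_⟩⟩
    have : IsRow 0 l ↔ l = fun _ => 0 :=
      ⟨fun h => funext fun i => h.2 i i.zero_le, fun h => h ▸ ⟨antitone_const, fun _ _ => rfl⟩⟩
    simp [rowVandermonde, patCount, this]
  | succ k ih =>
    obtain ⟨c, hc⟩ := ih
    refine ⟨c / ∏ j : Fin k, (-((j : ℝ) + 1)), fun l => ?_⟩
    have hprod : (∏ j : Fin k, (-((j : ℝ) + 1))) ≠ 0 :=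
      Finset.prod_ne_zero_iff.2 fun j _ => neg_ne_zero.2 (by positivity)
    by_cases hl : IsRow (k + 1) l
    · let e : (Fin k → ℕ) → ℕ → ℕ := fun m i => if h : i < k then m ⟨i, h⟩ else 0
      have he : Function.Injective e := by
        intro m m' h
        ext i
        simpa [e] using congrFun h i
      have hP : ∀ m : Fin k → ℕ, (∀ i : Fin k, m i ∈ Finset.Icc (l (i + 1)) (l i)) ↔
          (Interlace (e m) l ∧ IsRow k (e m)) := by
        intro m
        constructor
        · intro h
          have h1 : Interlace (e m) l := by
            intro i
            by_cases hi : i < k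
            · simpa [e, hi] using h ⟨i, hi⟩
            · simp [e, hi, hl.2 (i + 1) (by omega)]
          refine ⟨h1, antitone_nat_of_succ_le fun i => (h1 (i + 1)).2.trans (h1 i).1, ?_⟩
          intro i hi
          simp [e, hi]
        · rintro ⟨h, -⟩ i
          simpa [e] using h i
      have hsum : patCount (k + 1) l = ENNReal.ofReal
          (c * ∑ m ∈ Fintype.piFinset fun i : Fin k => Finset.Icc (l (i + 1)) (l i),
            (Matrix.vandermonde fun i : Fin k => ((m i + (k - 1 - i) : ℕ) : ℝ)).det) ∧
          0 ≤ c * ∑ m ∈ Fintype.piFinset fun i : Fin k => Finset.Icc (l (i + 1)) (l i),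
            (Matrix.vandermonde fun i : Fin k => ((m i + (k - 1 - i) : ℕ) : ℝ)).det := by
        have hrow : ∀ m : Fin k → ℕ, rowVandermonde k (e m) =
            (Matrix.vandermonde fun i : Fin k => ((m i + (k - 1 - i) : ℕ) : ℝ)).det := by
          intro m
          simp [rowVandermonde, shiftRow, e]
        have hnn : ∀ m ∈ Fintype.piFinset fun i : Fin k => Finset.Icc (l (i + 1)) (l i),
            0 ≤ c * (Matrix.vandermonde fun i : Fin k => ((m i + (k - 1 - i) : ℕ) : ℝ)).det := by
          intro m hm
          rw [← hrow]
          exact (hc _).1 ((hP m).1 (Fintype.mem_piFinset.1 hm)).2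
        rw [Finset.mul_sum]
        refine ⟨?_, Finset.sum_nonneg hnn⟩
        rw [patCount, ENNReal.ofReal_sum_of_nonneg hnn]
        simp only [(hc _).2, ← guardBy_and]
        rw [← tsum_guardBy_comp he hP, tsum_eq_sum]
        · refine Finset.sum_congr rfl fun m hm => ?_
          rw [guardBy_pos (Fintype.mem_piFinset.1 hm), hrow]
        · intro m hm
          exact guardBy_neg (fun h => hm (Fintype.mem_piFinset.2 h)) _
        · rintro μ ⟨-, hμ⟩
          refine ⟨fun i => μ i, ?_⟩
          ext i
          by_cases hi : i < k
          · simp [e, hi]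
          · simp [e, hi, hμ.2 i (by omega)]
      rw [sum_rowVandermonde k l hl.1] at hsum
      have e2 : c / (∏ j : Fin k, (-((j : ℝ) + 1))) * rowVandermonde (k + 1) l = c *
          (Matrix.of fun i j : Fin k => (((shiftRow (k + 1) l i.castSucc).descFactorial (j + 1) : ℝ) -
          (shiftRow (k + 1) l i.succ).descFactorial (j + 1)) / (j + 1)).det := by
        rw [rowVandermonde_succ, ← mul_assoc, div_mul_cancel₀ _ hprod]
      rw [guardBy_pos hl, e2]
      exact ⟨fun _ => hsum.2, hsum.1⟩
    · refine ⟨fun h => absurd h hl, ?_⟩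
      rw [guardBy_neg hl, patCount, ENNReal.tsum_eq_zero]
      intro μ
      rw [(hc μ).2, ← guardBy_and]
      refine guardBy_neg (fun h => hl ⟨h.1.antitone, fun i hi => ?_⟩) _
      obtain ⟨i, rfl⟩ : ∃ j, i = j + 1 := ⟨i - 1, by omega⟩
      exact Nat.le_zero.1 ((h.1 i).1.trans (h.2.2 i (by omega)).le)

theorem det_vandermonde_split {k : ℕ} (v : Fin k → ℝ) (a : Fin k) :
    (Matrix.vandermonde v).det =
      (∏ j ∈ Finset.univ.erase a, (if a < j then -1 else 1) * (v a - v j)) *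
        ∏ i ∈ Finset.univ.erase a, ∏ j ∈ Finset.univ.erase a, if i < j then v j - v i else 1 := by
  have h1 : (Matrix.vandermonde v).det = ∏ i, ∏ j, if i < j then v j - v i else 1 := by
    rw [Matrix.det_vandermonde]
    refine Finset.prod_congr rfl fun i _ => ?_
    rw [← Finset.prod_filter]
    congr 1
    ext j
    simp
  have ha := Finset.mem_univ a
  rw [h1, ← Finset.mul_prod_erase _ _ ha, ← Finset.mul_prod_erase _ _ ha, if_neg (lt_irrefl a),
    one_mul, Finset.prod_congr (s₁ := Finset.univ.erase a) rfl fun i _ =>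
      (Finset.mul_prod_erase Finset.univ (fun j => if i < j then v j - v i else 1) ha).symm,
    Finset.prod_mul_distrib, ← mul_assoc, ← Finset.prod_mul_distrib]
  congr 1
  refine Finset.prod_congr rfl fun j hj => ?_
  rcases lt_or_gt_of_ne (Finset.ne_of_mem_erase hj) with h | h
  · simp [h, h.not_gt]
  · simp [h, h.not_gt]

theorem det_vandermonde_update {k : ℕ} (v : Fin k → ℝ) (a : Fin k) (x : ℝ) :
    (Matrix.vandermonde (Function.update v a x)).det * ∏ j ∈ Finset.univ.erase a, (v a - v j) =
      (Matrix.vandermonde v).det * ∏ j ∈ Finset.univ.erase a, (x - v j) := by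
  rw [det_vandermonde_split _ a, det_vandermonde_split v a, Finset.prod_mul_distrib,
    Finset.prod_mul_distrib]
  have hu : ∀ j ∈ Finset.univ.erase a, Function.update v a x j = v j := fun j hj =>
    Function.update_of_ne (Finset.ne_of_mem_erase hj) _ _
  have e1 : ∏ j ∈ Finset.univ.erase a, (Function.update v a x a - Function.update v a x j) =
      ∏ j ∈ Finset.univ.erase a, (x - v j) :=
    Finset.prod_congr rfl fun j hj => by rw [hu j hj, Function.update_self]
  have e2 : (∏ i ∈ Finset.univ.erase a, ∏ j ∈ Finset.univ.erase a,
      if i < j then Function.update v a x j - Function.update v a x i else 1) =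
      ∏ i ∈ Finset.univ.erase a, ∏ j ∈ Finset.univ.erase a, if i < j then v j - v i else 1 :=
    Finset.prod_congr rfl fun i hi => Finset.prod_congr rfl fun j hj => by rw [hu i hi, hu j hj]
  rw [e1, e2]
  ring

/-- The parts of a partition, shifted to be strictly decreasing. -/
def rowPoint (l : ℕ → ℕ) (i : ℕ) : ℝ := (l i : ℝ) - i

/-- The rate at which a box is added to the part `i` of a partition. -/
noncomputable def addRate (k : ℕ) (l : ℕ → ℕ) (i : ℕ) : ℝ :=
  ∏ j ∈ (Finset.range k).erase i,
    (rowPoint l i - rowPoint l j + 1) / (rowPoint l i - rowPoint l j)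

theorem rowPoint_gap {l : ℕ → ℕ} (hl : Antitone l) {i j : ℕ} (h : i < j) :
    rowPoint l j + 1 ≤ rowPoint l i := by
  have h1 : (l j : ℝ) ≤ l i := by exact_mod_cast hl h.le
  have h2 : (i : ℝ) + 1 ≤ j := by exact_mod_cast h
  unfold rowPoint
  linarith

theorem addRate_nonneg {k : ℕ} {l : ℕ → ℕ} (hl : Antitone l) (i : ℕ) : 0 ≤ addRate k l i := by
  refine Finset.prod_nonneg fun j hj => ?_
  rcases lt_or_gt_of_ne (Finset.ne_of_mem_erase hj) with h | h
  · have := rowPoint_gap hl h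
    exact div_nonneg_of_nonpos (by linarith) (by linarith)
  · have := rowPoint_gap hl h
    exact div_nonneg (by linarith) (by linarith)

theorem shiftRow_eq_rowPoint {k : ℕ} (l : ℕ → ℕ) (i : Fin k) :
    (shiftRow k l i : ℝ) = rowPoint l i + ((k : ℝ) - 1) := by
  have h := i.2
  rw [shiftRow, Nat.sub_sub, Nat.cast_add, Nat.cast_sub (by omega), rowPoint]
  push_cast
  ring

theorem addRate_eq_prod {k : ℕ} (l : ℕ → ℕ) (i : Fin k) : addRate k l i =
    ∏ j ∈ Finset.univ.erase i, ((shiftRow k l i : ℝ) + 1 - shiftRow k l j) /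
      ((shiftRow k l i : ℝ) - shiftRow k l j) := by
  have h : (Finset.range k).erase i = (Finset.univ.erase i).map Fin.valEmbedding := by
    ext j
    simp only [Finset.mem_erase, Finset.mem_range, Finset.mem_map, Finset.mem_univ, and_true,
      Fin.valEmbedding_apply]
    constructor
    · rintro ⟨h1, h2⟩
      exact ⟨⟨j, h2⟩, fun h => h1 (congrArg Fin.val h), rfl⟩
    · rintro ⟨j, h, rfl⟩
      exact ⟨fun h' => h (Fin.ext h'), j.2⟩
  rw [addRate, h, Finset.prod_map]
  refine Finset.prod_congr rfl fun j _ => ?_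
  rw [shiftRow_eq_rowPoint, shiftRow_eq_rowPoint, Fin.valEmbedding_apply]
  congr 1 <;> ring

theorem rowVandermonde_incr {k : ℕ} {l : ℕ → ℕ} (hl : Antitone l) (i : Fin k) :
    rowVandermonde k (incr i l) = addRate k l i * rowVandermonde k l := by
  have h := det_vandermonde_update (fun j : Fin k => (shiftRow k l j : ℝ)) i (shiftRow k l i + 1)
  have e : (fun j : Fin k => (shiftRow k (incr i l) j : ℝ)) =
      Function.update (fun j : Fin k => (shiftRow k l j : ℝ)) i (shiftRow k l i + 1) := by
    ext j
    by_cases hj : j = i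
    · subst hj
      simp [shiftRow, incr_apply]
      ring
    · have : (j : ℕ) ≠ i := fun h => hj (Fin.ext h)
      simp [shiftRow, incr_apply, hj, this]
  have hne : ∏ j ∈ Finset.univ.erase i, ((shiftRow k l i : ℝ) - shiftRow k l j) ≠ 0 := by
    refine Finset.prod_ne_zero_iff.2 fun j hj => ?_
    rw [shiftRow_eq_rowPoint, shiftRow_eq_rowPoint]
    rcases lt_or_gt_of_ne (Finset.ne_of_mem_erase hj) with h | h
    · have := rowPoint_gap hl (show (j : ℕ) < i from h)
      linarith
    · have := rowPoint_gap hl (show (i : ℕ) < j from h)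
      linarith
  rw [rowVandermonde, rowVandermonde, e, addRate_eq_prod, Finset.prod_div_distrib,
    div_mul_eq_mul_div, eq_div_iff hne, h, mul_comm]

theorem addRate_eq_zero {k : ℕ} {l : ℕ → ℕ} {i : ℕ} (hi : i + 1 < k) (h : l (i + 1) = l i) :
    addRate k l (i + 1) = 0 := by
  refine Finset.prod_eq_zero (i := i) (by simp; omega) ?_
  simp [rowPoint, h]

theorem patCount_incr (k : ℕ) (i : ℕ) (l : ℕ → ℕ) :
    guardBy (incr i l (i + 1) < incr i l i) (patCount k (incr i l)) =
      (if i < k then ENNReal.ofReal (addRate k l i) else 0) * patCount k l := by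
  obtain ⟨c, hc⟩ := patCount_eq k
  rw [(hc _).2, (hc l).2, ← guardBy_and]
  by_cases hl : IsRow k l
  · rw [guardBy_pos hl]
    by_cases hi : i < k
    · rw [if_pos hi, ← ENNReal.ofReal_mul (addRate_nonneg hl.1 i)]
      have hcor : incr i l (i + 1) < incr i l i := by
        have := hl.1 (Nat.le_succ i)
        simp [incr_apply]
        omega
      by_cases hrow : IsRow k (incr i l)
      · rw [guardBy_pos ⟨hcor, hrow⟩, rowVandermonde_incr hl.1 ⟨i, hi⟩]
        congr 1
        ring
      · rw [guardBy_neg fun h => hrow h.2]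
        have : addRate k l i = 0 := by
          by_contra hne
          apply hrow
          refine ⟨antitone_nat_of_succ_le fun j => ?_, fun j hj => ?_⟩
          · have h1 := hl.1 (Nat.le_succ j)
            have h2 : i = j + 1 → l (j + 1) ≠ l j := by
              rintro rfl h
              exact hne (addRate_eq_zero hi h)
            simp only [incr_apply]
            grind
          · have := hl.2 j hj
            simp only [incr_apply]
            grind
        simp [this]
    · rw [if_neg hi, zero_mul]
      refine guardBy_neg (fun h => ?_) _
      have := h.2.2 i (not_lt.1 hi)
      simp [incr_apply] at this
  · rw [guardBy_neg hl, mul_zero]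
    refine guardBy_neg (fun h => hl ⟨antitone_nat_of_succ_le fun j => ?_, fun j hj => ?_⟩) _
    · have h1 := h.1
      have h2 := h.2.1 (Nat.le_succ j)
      simp only [incr_apply] at h1 h2
      grind
    · have h2 := h.2.2 j hj
      simp only [incr_apply] at h2
      grind

theorem GTValid.isRow {k : ℕ} {p : GTPat k} (h : GTValid k p) : IsRow k (gtTop k p) := by
  refine ⟨h.antitone, ?_⟩
  induction k with
  | zero => exact fun _ _ => rfl
  | succ k ih =>
    obtain ⟨p, l, rfl⟩ := exists_eq_gtCons p
    intro i hi
    obtain ⟨i, rfl⟩ : ∃ j, i = j + 1 := ⟨i - 1, by omega⟩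
    exact Nat.le_zero.1 ((h.2 i).1.trans (ih h.1 i (by omega)).le)

/-- The pattern obtained by inserting a word. -/
def wordPat {k n : ℕ} (u : Fin n → Fin k) : GTPat k :=
  runWord (fun p a => (gtStep k p a).1) (gtZero k) u

theorem wordPat_spec {k n : ℕ} (u : Fin n → Fin k) :
    gtLevel k (wordPat u) = runWord levelStep (fun _ => 0) u ∧ GTValid k (wordPat u) := by
  have := runWord_hom (fun p a => (gtStep k p a).1) levelStep (gtLevel k) (GTValid k) k
    (fun p a ha hp => (gtStep_valid k p hp a ha).1)
    (fun p a ha hp => funext fun b => gtLevel_step k p hp a ha b) (gtZero k)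
    ((gtValid_and_top_eq_zero_iff k _).2 rfl).1 u
  rwa [gtLevel_gtZero] at this

theorem sum_addRate (k n m : ℕ) (hm : m ≤ k) :
    ∑ u : Fin n → Fin k, ∑ a ∈ Finset.range k,
      (if (gtStep k (wordPat u) a).2 < m then (1 : ℝ) else 0) =
    ∑ u : Fin n → Fin k, ∑ i ∈ Finset.range m, addRate k (gtTop k (wordPat u)) i := by
  have h := sum_sum_gtStep k n _ (patCount_incr k) fun _ i => if i < m then 1 else 0
  have e1 : ∑ u : Fin n → Fin k, ∑ a ∈ Finset.range k,
      (if (gtStep k (wordPat u) a).2 < m then (1 : ENNReal) else 0) =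
      ENNReal.ofReal (∑ u : Fin n → Fin k, ∑ a ∈ Finset.range k,
        (if (gtStep k (wordPat u) a).2 < m then (1 : ℝ) else 0)) := by
    rw [ENNReal.ofReal_sum_of_nonneg
      fun _ _ => Finset.sum_nonneg fun _ _ => by split_ifs <;> norm_num]
    refine Finset.sum_congr rfl fun u _ => ?_
    rw [ENNReal.ofReal_sum_of_nonneg fun _ _ => by split_ifs <;> norm_num]
    refine Finset.sum_congr rfl fun a _ => ?_
    split_ifs <;> simp
  have hnn : ∀ u : Fin n → Fin k, ∀ i, 0 ≤ addRate k (gtTop k (wordPat u)) i := fun u i =>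
    addRate_nonneg (wordPat_spec u).2.isRow.1 i
  have e2 : ∑ u : Fin n → Fin k, ∑' i,
      (if i < k then ENNReal.ofReal (addRate k (gtTop k (wordPat u)) i) else 0) *
        (if i < m then 1 else 0) =
      ENNReal.ofReal (∑ u : Fin n → Fin k, ∑ i ∈ Finset.range m,
        addRate k (gtTop k (wordPat u)) i) := by
    rw [ENNReal.ofReal_sum_of_nonneg fun u _ => Finset.sum_nonneg fun i _ => hnn u i]
    refine Finset.sum_congr rfl fun u _ => ?_
    rw [ENNReal.ofReal_sum_of_nonneg fun i _ => hnn u i, tsum_eq_sum (s := Finset.range m)]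
    · refine Finset.sum_congr rfl fun i hi => ?_
      have := Finset.mem_range.1 hi
      rw [if_pos (by omega), if_pos this, mul_one]
    · intro i hi
      rw [if_neg (c := i < m) (by simpa using hi), mul_zero]
  have h' := e1.symm.trans (h.trans e2)
  refine (ENNReal.ofReal_eq_ofReal_iff ?_ ?_).1 h'
  · exact Finset.sum_nonneg fun _ _ => Finset.sum_nonneg fun _ _ => by split_ifs <;> norm_num
  · exact Finset.sum_nonneg fun u _ => Finset.sum_nonneg fun i _ => hnn u i

/-- The sum over all words of the sum of the first `m` parts of the shape of the word. -/
noncomputable def topSum (k n m : ℕ) : ℝ :=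
  ∑ u : Fin n → Fin k, ∑ i ∈ Finset.range m, (gtTop k (wordPat u) i : ℝ)

theorem topSum_zero (k m : ℕ) : topSum k 0 m = 0 := by
  simp [topSum, wordPat, runWord_zero, gtTop_gtZero]

theorem topSum_succ (k n m : ℕ) (hm : m ≤ k) : topSum k (n + 1) m = k * topSum k n m +
    ∑ u : Fin n → Fin k, ∑ i ∈ Finset.range m, addRate k (gtTop k (wordPat u)) i := by
  rw [← sum_addRate k n m hm, topSum, topSum]
  refine (sum_runWord_snoc (fun p a => (gtStep k p a).1) (gtZero k) k n
    fun p => ∑ i ∈ Finset.range m, (gtTop k p i : ℝ)).trans ?_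
  rw [Finset.mul_sum, ← Finset.sum_add_distrib]
  refine Finset.sum_congr rfl fun u _ => ?_
  have e : ∀ a ∈ Finset.range k, ∑ i ∈ Finset.range m, (gtTop k (gtStep k (wordPat u) a).1 i : ℝ) =
      (∑ i ∈ Finset.range m, (gtTop k (wordPat u) i : ℝ)) +
        if (gtStep k (wordPat u) a).2 < m then (1 : ℝ) else 0 := by
    intro a ha
    rw [(gtStep_valid k _ (wordPat_spec u).2 a (Finset.mem_range.1 ha)).2]
    have : ∀ i, ((incr (gtStep k (wordPat u) a).2 (gtTop k (wordPat u)) i : ℕ) : ℝ) =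
        gtTop k (wordPat u) i + if i = (gtStep k (wordPat u) a).2 then 1 else 0 := by
      intro i
      rw [incr_apply]
      split_ifs with h
      · simp [h]
      · simp
    simp only [this, Finset.sum_add_distrib, Finset.sum_ite_eq', Finset.mem_range]
  refine (Finset.sum_congr rfl e).trans ?_
  rw [Finset.sum_add_distrib]
  simp

theorem expLNDS_eq_topSum (k n : ℕ) (hk : 1 ≤ k) : expLNDS k n = topSum k n 1 / (k : ℝ) ^ n := by
  rw [expLNDS_eq_levelSum k n hk, levelSum, topSum]
  push_cast
  congr 1
  refine Finset.sum_congr rfl fun u _ => ?_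
  rw [Finset.sum_range_one, ← gtLevel_eq_top k _ (k - 1) (by omega), (wordPat_spec u).1]

/-- The coefficients of a partial fraction decomposition. -/
noncomputable def pfCoeff (x : ℕ → ℝ) (s : Finset ℕ) (i : ℕ) : ℝ :=
  ∏ j ∈ s.erase i, (x i - x j + 1) / (x i - x j)

theorem pfCoeff_insert_of_mem {x : ℕ → ℝ} (hx : Function.Injective x) {s : Finset ℕ} {a i : ℕ}
    (ha : a ∉ s) (hi : i ∈ s) :
    pfCoeff x (insert a s) i = pfCoeff x s i * (1 + 1 / (x i - x a)) := by
  have hne : a ≠ i := fun h => ha (h ▸ hi)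
  have hne' : x i - x a ≠ 0 := sub_ne_zero.2 (hx.ne hne.symm)
  rw [pfCoeff, pfCoeff, Finset.erase_insert_of_ne hne,
    Finset.prod_insert fun h => ha (Finset.mem_of_mem_erase h), mul_comm]
  congr 1
  field_simp

theorem pfCoeff_insert_self {x : ℕ → ℝ} (hx : Function.Injective x) {s : Finset ℕ} {a : ℕ}
    (ha : a ∉ s) : pfCoeff x (insert a s) a = ∏ i ∈ s, (1 - 1 / (x i - x a)) := by
  rw [pfCoeff, Finset.erase_insert ha]
  refine Finset.prod_congr rfl fun i hi => ?_
  have h1 : x a - x i ≠ 0 := sub_ne_zero.2 (hx.ne fun h => ha (h ▸ hi))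
  have h2 : x i - x a ≠ 0 := sub_ne_zero.2 (hx.ne fun h => ha (h ▸ hi))
  field_simp
  ring

theorem sum_pfCoeff_div {x : ℕ → ℝ} (hx : Function.Injective x) (s : Finset ℕ) (c : ℝ)
    (hc : ∀ i ∈ s, x i ≠ c) :
    ∑ i ∈ s, pfCoeff x s i / (x i - c) = 1 - ∏ i ∈ s, (1 - 1 / (x i - c)) := by
  induction s using Finset.induction_on generalizing c with
  | empty => simp
  | insert a s ha ih =>
    have hac : x a - c ≠ 0 := sub_ne_zero.2 (hc a (Finset.mem_insert_self a s))
    have ih1 := ih c fun i hi => hc i (Finset.mem_insert_of_mem hi)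
    have ih2 := ih (x a) fun i hi => hx.ne fun h => ha (h ▸ hi)
    rw [Finset.sum_insert ha, Finset.prod_insert ha, pfCoeff_insert_self hx ha]
    have e : ∑ i ∈ s, pfCoeff x (insert a s) i / (x i - c) =
        ∑ i ∈ s, (pfCoeff x s i / (x i - c) +
          (pfCoeff x s i / (x i - x a) - pfCoeff x s i / (x i - c)) / (x a - c)) := by
      refine Finset.sum_congr rfl fun i hi => ?_
      have h1 : x i - c ≠ 0 := sub_ne_zero.2 (hc i (Finset.mem_insert_of_mem hi))
      have h2 : x i - x a ≠ 0 := sub_ne_zero.2 (hx.ne fun h => ha (h ▸ hi))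
      rw [pfCoeff_insert_of_mem hx ha hi]
      field_simp
      ring
    rw [e, Finset.sum_add_distrib, ← Finset.sum_div, Finset.sum_sub_distrib, ih1, ih2]
    field_simp
    ring

theorem sum_pfCoeff {x : ℕ → ℝ} (hx : Function.Injective x) (s : Finset ℕ) :
    ∑ i ∈ s, pfCoeff x s i = s.card := by
  induction s using Finset.induction_on with
  | empty => simp
  | insert a s ha ih =>
    have h := sum_pfCoeff_div hx s (x a) fun i hi => hx.ne fun h => ha (h ▸ hi)
    have e : ∑ i ∈ s, pfCoeff x (insert a s) i =
        ∑ i ∈ s, (pfCoeff x s i + pfCoeff x s i / (x i - x a)) := by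
      refine Finset.sum_congr rfl fun i hi => ?_
      rw [pfCoeff_insert_of_mem hx ha hi]
      ring
    rw [Finset.sum_insert ha, pfCoeff_insert_self hx ha, e, Finset.sum_add_distrib, h, ih,
      Finset.card_insert_of_notMem ha]
    push_cast
    ring

theorem div_le_prod_one_sub (z : ℕ → ℝ) (hz : ∀ i, z (i + 1) + 1 ≤ z i) (m : ℕ) (hm : 1 ≤ z m) :
    z m / (z m + m) ≤ ∏ i ∈ Finset.range m, (1 - 1 / z i) := by
  induction m with
  | zero => simp; exact div_le_one_of_le₀ le_rfl (by linarith)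
  | succ m ih =>
    have h1 := hz m
    have h2 := ih (by linarith)
    have hpos : 0 < z m := by linarith
    rw [Finset.prod_range_succ]
    have h3 : 0 ≤ 1 - 1 / z m := by
      rw [sub_nonneg, div_le_one hpos]; linarith
    refine le_trans ?_ (mul_le_mul_of_nonneg_right h2 h3)
    have hm0 : (0 : ℝ) ≤ m := m.cast_nonneg
    have e : z m / (z m + m) * (1 - 1 / z m) = (z m - 1) / (z m + m) := by
      have : z m + m ≠ 0 := by positivity
      field_simp
    rw [e, div_le_div_iff₀ (by push_cast; linarith) (by linarith)]
    push_cast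
    nlinarith

theorem sum_one_div_le (z : ℕ → ℝ) (hz : ∀ i, z (i + 1) + 1 ≤ z i) (m : ℕ)
    (hm : ∀ i < m, 1 ≤ z i) :
    ∑ i ∈ Finset.range m, 1 / (z i + i) ≤ 1 - ∏ i ∈ Finset.range m, (1 - 1 / z i) := by
  induction m with
  | zero => simp
  | succ m ih =>
    have h1 := ih fun i hi => hm i (by omega)
    have h0 := hm m (by omega)
    have h2 := div_le_prod_one_sub z hz m h0
    rw [Finset.sum_range_succ, Finset.prod_range_succ]
    have h3 : 1 / (z m + m) ≤ (∏ i ∈ Finset.range m, (1 - 1 / z i)) * (1 / z m) := by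
      refine le_trans (le_of_eq ?_) (mul_le_mul_of_nonneg_right h2 (by positivity))
      have hpos : 0 < z m := by linarith
      have : z m + m ≠ 0 := by positivity
      field_simp
    linarith

theorem one_add_sum_le_prod {ι : Type*} (s : Finset ι) (f : ι → ℝ) (hf : ∀ i ∈ s, 0 ≤ f i) :
    1 + ∑ i ∈ s, f i ≤ ∏ i ∈ s, (1 + f i) := by
  classical
  induction s using Finset.induction_on with
  | empty => simp
  | insert a s ha ih =>
    have h1 := ih fun i hi => hf i (Finset.mem_insert_of_mem hi)
    have h2 := hf a (Finset.mem_insert_self a s)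
    have h3 := Finset.sum_nonneg fun i hi => hf i (Finset.mem_insert_of_mem hi)
    rw [Finset.sum_insert ha, Finset.prod_insert ha]
    nlinarith

theorem rowPoint_injective {l : ℕ → ℕ} (hl : Antitone l) : Function.Injective (rowPoint l) := by
  have : StrictAnti (rowPoint l) := fun i j h => by linarith [rowPoint_gap hl h]
  exact this.injective

theorem addRate_split {k m : ℕ} (hm : m ≤ k) {l : ℕ → ℕ} (hl : Antitone l) {i : ℕ} (hi : i < m) :
    addRate k l i = pfCoeff (rowPoint l) (Finset.range m) i *
      ∏ j ∈ Finset.Ico m k, (1 + 1 / (rowPoint l i - rowPoint l j)) := by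
  have h : (Finset.range k).erase i = (Finset.range m).erase i ∪ Finset.Ico m k := by
    ext j
    simp only [Finset.mem_erase, Finset.mem_range, Finset.mem_union, Finset.mem_Ico]
    omega
  rw [addRate, h, Finset.prod_union, pfCoeff]
  · congr 1
    refine Finset.prod_congr rfl fun j hj => ?_
    have hne : rowPoint l i - rowPoint l j ≠ 0 := by
      refine sub_ne_zero.2 ((rowPoint_injective hl).ne ?_)
      have := (Finset.mem_Ico.1 hj).1
      omega
    field_simp
  · refine Finset.disjoint_left.2 fun j h1 h2 => ?_
    simp at h1 h2
    omega

theorem le_sum_addRate {k m : ℕ} (hm : m ≤ k) {l : ℕ → ℕ} (hl : Antitone l) :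
    m + ∑ i ∈ Finset.range m, ∑ j ∈ Finset.Ico m k, 1 / ((l i : ℝ) - l j + k) ≤
      ∑ i ∈ Finset.range m, addRate k l i := by
  set x := rowPoint l with hx
  have hinj := rowPoint_injective hl
  have h1 : ∑ i ∈ Finset.range m, (pfCoeff x (Finset.range m) i +
      ∑ j ∈ Finset.Ico m k, pfCoeff x (Finset.range m) i / (x i - x j)) ≤
      ∑ i ∈ Finset.range m, addRate k l i := by
    refine Finset.sum_le_sum fun i hi => ?_
    have hi := Finset.mem_range.1 hi
    rw [addRate_split hm hl hi]
    have hA : 0 ≤ pfCoeff x (Finset.range m) i := addRate_nonneg (k := m) hl i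
    refine le_trans (le_of_eq ?_) (mul_le_mul_of_nonneg_left (one_add_sum_le_prod _ _ ?_) hA)
    · rw [mul_add, Finset.mul_sum, mul_one]
      simp [div_eq_mul_inv]
      rfl
    · intro j hj
      have := rowPoint_gap hl (show i < j by have := (Finset.mem_Ico.1 hj).1; omega)
      exact one_div_nonneg.2 (by linarith)
  refine le_trans ?_ h1
  rw [Finset.sum_add_distrib, sum_pfCoeff hinj, Finset.card_range, Finset.sum_comm,
    Finset.sum_comm (s := Finset.range m)]
  refine add_le_add le_rfl (Finset.sum_le_sum fun j hj => ?_)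
  have hj := Finset.mem_Ico.1 hj
  rw [sum_pfCoeff_div hinj _ _ fun i hi => hinj.ne (by have := Finset.mem_range.1 hi; omega)]
  refine le_trans ?_ (sum_one_div_le (fun i => x i - x j)
    (fun i => by linarith [rowPoint_gap hl i.lt_succ_self]) m fun i hi => by
      linarith [rowPoint_gap hl (show i < j by omega)])
  refine Finset.sum_le_sum fun i hi => ?_
  have hi := Finset.mem_range.1 hi
  have hij := rowPoint_gap hl (show i < j by omega)
  have hi0 : (0 : ℝ) ≤ i := i.cast_nonneg
  refine one_div_le_one_div_of_le (by linarith) ?_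
  have : (j : ℝ) ≤ k := by exact_mod_cast hj.2.le
  simp only [hx, rowPoint]
  linarith

theorem det_vandermonde_const_mul {k : ℕ} (c : ℝ) (x : Fin k → ℝ) :
    (Matrix.vandermonde fun i => c * x i).det =
      c ^ (∑ j : Fin k, (j : ℕ)) * (Matrix.vandermonde x).det := by
  rw [← Finset.prod_pow_eq_pow_sum, ← Matrix.det_mul_row]
  congr 1
  ext i j
  simp [Matrix.vandermonde_apply, mul_pow]

/-- There is a system of distinct points in electrostatic equilibrium in a harmonic potential. -/
theorem exists_equilibrium_fin (k : ℕ) (hk : 2 ≤ k) : ∃ h : Fin k → ℝ, Function.Injective h ∧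
    ∀ i, ∑ j ∈ Finset.univ.erase i, 1 / (h i - h j) = h i := by
  obtain ⟨N, hN⟩ : ∃ N, N = ∑ j : Fin k, (j : ℕ) := ⟨_, rfl⟩
  have hN1 : 1 ≤ N := by
    rw [hN]
    exact Finset.single_le_sum (f := fun j : Fin k => (j : ℕ)) (fun _ _ => Nat.zero_le _)
      (Finset.mem_univ (⟨1, hk⟩ : Fin k))
  have hN1' : (1 : ℝ) ≤ N := by exact_mod_cast hN1
  set D : (Fin k → ℝ) → ℝ := fun x => (Matrix.vandermonde x).det with hD
  have hDc : Continuous D := by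
    refine Continuous.matrix_det (continuous_matrix fun i j => ?_)
    simp only [Matrix.vandermonde_apply]
    fun_prop
  set S : Set (Fin k → ℝ) := {x | ∑ i, x i ^ 2 = N} with hS
  have hSc : IsCompact S := by
    refine IsCompact.of_isClosed_subset (isCompact_Icc (a := fun _ : Fin k => -(N : ℝ))
      (b := fun _ : Fin k => (N : ℝ))) (isClosed_eq (by fun_prop) continuous_const) ?_
    intro x hx
    have hx' : ∀ i, |x i| ≤ N := by
      intro i
      have h1 : x i ^ 2 ≤ N := by
        rw [← show ∑ i, x i ^ 2 = (N : ℝ) from hx]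
        exact Finset.single_le_sum (f := fun i => x i ^ 2) (fun _ _ => sq_nonneg _)
          (Finset.mem_univ i)
      exact abs_le_of_sq_le_sq (by nlinarith) (by linarith)
    exact ⟨fun i => (abs_le.1 (hx' i)).1, fun i => (abs_le.1 (hx' i)).2⟩
  have hscale : ∀ x : Fin k → ℝ, 0 < ∑ i, x i ^ 2 → ∃ y ∈ S,
      D y ^ 2 = (N / ∑ i, x i ^ 2) ^ N * D x ^ 2 := by
    intro x hx
    have hc : √(N / ∑ i, x i ^ 2) ^ 2 = N / ∑ i, x i ^ 2 := Real.sq_sqrt (by positivity)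
    refine ⟨fun i => √(N / ∑ i, x i ^ 2) * x i, ?_, ?_⟩
    · simp only [hS, Set.mem_ofPred_eq, mul_pow, ← Finset.mul_sum, hc]
      field_simp
    · simp only [hD]
      rw [det_vandermonde_const_mul, ← hN, mul_pow, ← pow_mul, mul_comm N 2, pow_mul, hc]
  have hx0 : D (fun i => (i : ℝ)) ≠ 0 := by
    refine Matrix.det_vandermonde_ne_zero_iff.2 fun i j h => ?_
    exact Fin.ext (by exact_mod_cast h)
  have hT0 : 0 < ∑ i : Fin k, ((i : ℕ) : ℝ) ^ 2 := by
    refine lt_of_lt_of_le one_pos ?_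
    have := Finset.single_le_sum (f := fun j : Fin k => ((j : ℕ) : ℝ) ^ 2)
      (fun _ _ => sq_nonneg _) (Finset.mem_univ (⟨1, hk⟩ : Fin k))
    simpa using this
  obtain ⟨y0, hy0, hy0'⟩ := hscale (fun i => (i : ℝ)) hT0
  obtain ⟨h, hh, hmax⟩ : ∃ h ∈ S, ∀ x ∈ S, D x ^ 2 ≤ D h ^ 2 := by
    obtain ⟨h, hh, hmax⟩ := hSc.exists_isMaxOn ⟨y0, hy0⟩ (hDc.pow 2).continuousOn
    exact ⟨h, hh, fun x hx => hmax hx⟩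
  have hDpos : 0 < D h ^ 2 := by
    refine lt_of_lt_of_le ?_ (hmax y0 hy0)
    rw [hy0']
    positivity
  have hinj : Function.Injective h :=
    Matrix.det_vandermonde_ne_zero_iff.1 fun h0 => hDpos.ne' (by simp [hD, h0])
  refine ⟨h, hinj, fun i => ?_⟩
  have hh' : ∑ i, h i ^ 2 = N := hh
  set p : ℝ → ℝ := fun t => ∏ j ∈ Finset.univ.erase i, (1 + t / (h i - h j)) with hp
  set T : ℝ → ℝ := fun t => N + 2 * t * h i + t ^ 2 with hT
  have hne : ∀ j ∈ Finset.univ.erase i, h i - h j ≠ 0 := fun j hj =>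
    sub_ne_zero.2 (hinj.ne (Finset.ne_of_mem_erase hj).symm)
  have hDu : ∀ t, D (Function.update h i (h i + t)) = D h * p t := by
    intro t
    have h1 := det_vandermonde_update h i (h i + t)
    have h2 : ∏ j ∈ Finset.univ.erase i, (h i + t - h j) =
        p t * ∏ j ∈ Finset.univ.erase i, (h i - h j) := by
      rw [hp, ← Finset.prod_mul_distrib]
      refine Finset.prod_congr rfl fun j hj => ?_
      have := hne j hj
      field_simp
      ring
    rw [h2, ← mul_assoc] at h1
    exact mul_right_cancel₀ (Finset.prod_ne_zero_iff.2 hne) h1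
  have hTu : ∀ t, ∑ j, Function.update h i (h i + t) j ^ 2 = T t := by
    intro t
    rw [← Finset.add_sum_erase _ _ (Finset.mem_univ i)] at hh' ⊢
    rw [Function.update_self, Finset.sum_congr rfl fun j hj => by
      rw [Function.update_of_ne (Finset.ne_of_mem_erase hj)]]
    simp only [hT]
    linarith
  have hT0 : T 0 = N := by simp [hT]
  have hp0 : p 0 = 1 := by simp [hp]
  have hTc : Continuous T := by fun_prop
  have hloc : IsLocalMax (fun t => p t ^ 2 * (N : ℝ) ^ N - T t ^ N) 0 := by
    have hev : ∀ᶠ t in nhds (0 : ℝ), 0 < T t :=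
      hTc.continuousAt.eventually (lt_mem_nhds (by rw [hT0]; linarith))
    filter_upwards [hev] with t ht
    obtain ⟨y, hy, hy'⟩ := hscale (Function.update h i (h i + t)) (by rw [hTu]; exact ht)
    have h1 := hmax y hy
    rw [hy', hTu, hDu, mul_pow, div_pow, mul_comm (D h ^ 2), ← mul_assoc] at h1
    have h2 := (mul_le_iff_le_one_left hDpos).1 h1
    rw [div_mul_eq_mul_div, div_le_one (by positivity)] at h2
    rw [hp0, hT0]
    linarith
  have hpd : HasDerivAt p (∑ j ∈ Finset.univ.erase i, 1 / (h i - h j)) 0 := by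
    have := HasDerivAt.fun_finsetProd (u := Finset.univ.erase i) (x := (0 : ℝ))
      (f := fun j t => 1 + t / (h i - h j)) (f' := fun j => 1 / (h i - h j))
      fun j _ => ((hasDerivAt_id (0 : ℝ)).div_const (h i - h j)).const_add 1
    simpa using this
  have hTd : HasDerivAt T (2 * h i) 0 := by
    have := (((hasDerivAt_id (0 : ℝ)).const_mul 2).mul_const (h i)).const_add (N : ℝ)
    have := this.fun_add (hasDerivAt_pow 2 (0 : ℝ))
    simpa using this
  have hd := hloc.hasDerivAt_eq_zero (((hpd.pow 2).mul_const ((N : ℝ) ^ N)).sub (hTd.pow N))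
  rw [hp0, hT0] at hd
  have hNN : (N : ℝ) ^ N = N * (N : ℝ) ^ (N - 1) := by
    rw [← pow_succ', Nat.sub_add_cancel hN1]
  have hpos : 0 < (N : ℝ) ^ N := by positivity
  have : (N : ℝ) ^ N * (∑ j ∈ Finset.univ.erase i, 1 / (h i - h j) - h i) = 0 := by
    have e : (2 : ℝ) * (∑ j ∈ Finset.univ.erase i, 1 / (h i - h j)) * (N : ℝ) ^ N -
        N * (N : ℝ) ^ (N - 1) * (2 * h i) = 0 := by simpa using hd
    rw [← hNN] at e
    linarith
  exact sub_eq_zero.1 ((mul_eq_zero.1 this).resolve_left hpos.ne')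

/-- A decreasing system of `k` points in electrostatic equilibrium in a harmonic potential. -/
structure IsEquilibrium (k : ℕ) (h : ℕ → ℝ) : Prop where
  lt : ∀ i j, i < j → j < k → h j < h i
  eq : ∀ i < k, ∑ j ∈ (Finset.range k).erase i, 1 / (h i - h j) = h i

theorem exists_equilibrium (k : ℕ) (hk : 1 ≤ k) : ∃ h, IsEquilibrium k h := by
  rcases hk.eq_or_lt with rfl | hk
  · refine ⟨fun _ => 0, fun i j _ _ => by omega, fun i _ => by simp⟩
  · obtain ⟨g, hinj, hg⟩ := exists_equilibrium_fin k hk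
    obtain ⟨σ, hσ⟩ : ∃ σ : Equiv.Perm (Fin k), Antitone (g ∘ σ) := by
      refine ⟨Tuple.sort fun i => -g i, fun i j hij => ?_⟩
      have := Tuple.monotone_sort (fun i => -g i) hij
      simpa using this
    have hσ' : StrictAnti (g ∘ σ) := hσ.strictAnti_of_injective (hinj.comp σ.injective)
    refine ⟨fun i => if hi : i < k then g (σ ⟨i, hi⟩) else 0, fun i j hij hj => ?_, fun i hi => ?_⟩
    · simp only [hj, hij.trans hj, dif_pos]
      exact hσ' hij
    · simp only [hi, dif_pos]
      refine (Finset.sum_bij' (fun j hj => σ ⟨j, Finset.mem_range.1 (Finset.mem_of_mem_erase hj)⟩)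
        (fun j _ => (σ.symm j : ℕ)) ?_ ?_ ?_ ?_ ?_).trans (hg (σ ⟨i, hi⟩))
      · intro j hj
        simp only [Finset.mem_erase, Finset.mem_univ, and_true]
        intro h
        exact Finset.ne_of_mem_erase hj (congrArg Fin.val (σ.injective h))
      · intro j hj
        simp only [Finset.mem_erase, Finset.mem_range, Fin.is_lt, and_true]
        intro h
        refine Finset.ne_of_mem_erase hj ?_
        rw [← σ.apply_symm_apply j]
        exact congrArg σ (Fin.ext h)
      · intro j hj
        simp
      · intro j hj
        simp
      · intro j hj
        simp only [Finset.mem_range.1 (Finset.mem_of_mem_erase hj), dif_pos]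

namespace IsEquilibrium

variable {k : ℕ} {h : ℕ → ℝ}

theorem sum_eq (H : IsEquilibrium k h) {i : ℕ} (hi : i < k) :
    ∑ j ∈ Finset.range k, 1 / (h i - h j) = h i := by
  rw [← Finset.add_sum_erase _ _ (Finset.mem_range.2 hi), H.eq i hi]
  simp

theorem ne (H : IsEquilibrium k h) {i j : ℕ} (hi : i < k) (hj : j < k) (hij : i ≠ j) :
    h i ≠ h j := by
  rcases lt_or_gt_of_ne hij with h' | h'
  · exact (H.lt _ _ h' hj).ne'
  · exact (H.lt _ _ h' hi).ne

theorem sum_antisymm (h : ℕ → ℝ) (s : Finset ℕ) : ∑ i ∈ s, ∑ j ∈ s, 1 / (h i - h j) = 0 := by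
  have h1 : ∑ i ∈ s, ∑ j ∈ s, 1 / (h i - h j) = -∑ i ∈ s, ∑ j ∈ s, 1 / (h i - h j) := by
    nth_rewrite 1 [Finset.sum_comm]
    rw [← Finset.sum_neg_distrib]
    refine Finset.sum_congr rfl fun i _ => ?_
    rw [← Finset.sum_neg_distrib]
    refine Finset.sum_congr rfl fun j _ => ?_
    rw [← neg_sub, one_div, one_div, inv_neg]
  linarith

theorem sum_cross (H : IsEquilibrium k h) {m : ℕ} (hm : m ≤ k) :
    ∑ i ∈ Finset.range m, ∑ j ∈ Finset.Ico m k, 1 / (h i - h j) = ∑ i ∈ Finset.range m, h i := by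
  rw [← zero_add (∑ i ∈ _, ∑ j ∈ _, _), ← sum_antisymm h (Finset.range m),
    ← Finset.sum_add_distrib]
  refine Finset.sum_congr rfl fun i hi => ?_
  rw [Finset.sum_range_add_sum_Ico _ hm, H.sum_eq ((Finset.mem_range.1 hi).trans_le hm)]

theorem sum_eq_zero (H : IsEquilibrium k h) : ∑ i ∈ Finset.range k, h i = 0 := by
  rw [← H.sum_cross le_rfl]
  simp

theorem le_zero (H : IsEquilibrium k h) {i : ℕ} (hi : i < k) : h i ≤ h 0 := by
  rcases i.eq_zero_or_pos with rfl | h0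
  · exact le_rfl
  · exact (H.lt 0 i h0 hi).le

theorem nonneg (H : IsEquilibrium k h) (hk : 1 ≤ k) : 0 ≤ h 0 := by
  by_contra hneg
  have : ∑ i ∈ Finset.range k, h i < 0 := Finset.sum_neg
    (fun i hi => (H.le_zero (Finset.mem_range.1 hi)).trans_lt (not_le.1 hneg)) ⟨0, by simpa⟩
  exact this.ne H.sum_eq_zero

theorem mul_le_sub (d : ℝ) (hd : ∀ i, i + 1 < k → d ≤ h i - h (i + 1)) {i j : ℕ} (hij : i ≤ j)
    (hj : j < k) : ((j : ℝ) - i) * d ≤ h i - h j := by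
  induction j, hij using Nat.le_induction with
  | base => simp
  | succ j hij ih =>
    have h1 := ih (by omega)
    have h2 := hd j hj
    push_cast
    linarith

theorem min_gap (H : IsEquilibrium k h) {i : ℕ} (hi : i + 1 < k)
    (hd : ∀ j, j + 1 < k → h i - h (i + 1) ≤ h j - h (j + 1)) :
    1 / (k : ℝ) ≤ (h i - h (i + 1)) ^ 2 := by
  set d := h i - h (i + 1) with hdef
  have hdpos : 0 < d := sub_pos.2 (H.lt _ _ i.lt_succ_self hi)
  have hgap := fun {i j : ℕ} => mul_le_sub (h := h) (k := k) (i := i) (j := j) d hd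
  have key : ∑ j ∈ Finset.range k, (1 / (h i - h j) - 1 / (h (i + 1) - h j)) = d := by
    rw [Finset.sum_sub_distrib, H.sum_eq (by omega), H.sum_eq hi]
  have hlow : ∀ j ∈ Finset.range i, (1 / d) * (1 / ((i : ℝ) + 1 - j) - 1 / ((i : ℝ) + 1 - (j + 1 : ℕ))) ≤
      1 / (h i - h j) - 1 / (h (i + 1) - h j) := by
    intro j hj
    have hj := Finset.mem_range.1 hj
    have hjr : (j : ℝ) + 1 ≤ i := by exact_mod_cast hj
    have h1 := hgap (i := j) (j := i) hj.le (by omega)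
    have h2 := hgap (i := j) (j := i + 1) (by omega) hi
    have e : 1 / (h i - h j) - 1 / (h (i + 1) - h j) = -(d / ((h j - h i) * (h j - h (i + 1)))) := by
      have n1 := sub_ne_zero.2 (H.ne (i := i) (j := j) (by omega) (by omega) (by omega))
      have n2 := sub_ne_zero.2 (H.ne (i := i + 1) (j := j) (by omega) (by omega) (by omega))
      have n3 : h j - h i ≠ 0 := by rw [← neg_sub]; exact neg_ne_zero.2 n1
      have n4 : h j - h (i + 1) ≠ 0 := by rw [← neg_sub]; exact neg_ne_zero.2 n2
      field_simp
      rw [hdef]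
      ring
    have p1 : 0 < (i : ℝ) - j := by linarith
    have p2 : 0 < (i : ℝ) + 1 - j := by linarith
    have p3 : (i : ℝ) + 1 - (j + 1 : ℕ) = i - j := by push_cast; ring
    rw [e, p3]
    have e2 : 1 / d * (1 / ((i : ℝ) + 1 - j) - 1 / (i - j)) =
        -(d / ((((i : ℝ) - j) * d) * ((((i + 1 : ℕ) : ℝ) - j) * d))) := by
      push_cast
      field_simp
      ring
    rw [e2, neg_le_neg_iff]
    refine div_le_div_of_nonneg_left hdpos.le (by push_cast; positivity) ?_
    exact mul_le_mul h1 h2 (by push_cast; positivity) (le_trans (by positivity) h1)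
  have hhigh : ∀ j ∈ Finset.range (k - (i + 2)),
      (1 / d) * (1 / ((j + 1 : ℕ) + 1 : ℝ) - 1 / ((j : ℝ) + 1)) ≤
      1 / (h i - h (i + 2 + j)) - 1 / (h (i + 1) - h (i + 2 + j)) := by
    intro j hj
    have hj := Finset.mem_range.1 hj
    have h1 := hgap (i := i) (j := i + 2 + j) (by omega) (by omega)
    have h2 := hgap (i := i + 1) (j := i + 2 + j) (by omega) (by omega)
    have e : 1 / (h i - h (i + 2 + j)) - 1 / (h (i + 1) - h (i + 2 + j)) =
        -(d / ((h i - h (i + 2 + j)) * (h (i + 1) - h (i + 2 + j)))) := by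
      have n1 := sub_ne_zero.2 (H.ne (i := i) (j := i + 2 + j) (by omega) (by omega) (by omega))
      have n2 := sub_ne_zero.2 (H.ne (i := i + 1) (j := i + 2 + j) (by omega) (by omega) (by omega))
      field_simp
      rw [hdef]
      ring
    have h1' : ((j : ℝ) + 2) * d ≤ h i - h (i + 2 + j) := by
      refine le_trans (le_of_eq ?_) h1; push_cast; ring
    have h2' : ((j : ℝ) + 1) * d ≤ h (i + 1) - h (i + 2 + j) := by
      refine le_trans (le_of_eq ?_) h2; push_cast; ring
    have e2 : (1 / d) * (1 / ((j + 1 : ℕ) + 1 : ℝ) - 1 / ((j : ℝ) + 1)) =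
        -(d / ((((j : ℝ) + 2) * d) * (((j : ℝ) + 1) * d))) := by
      have : (j : ℝ) + 1 + 1 ≠ 0 := by positivity
      push_cast
      field_simp
      ring
    rw [e, e2, neg_le_neg_iff]
    refine div_le_div_of_nonneg_left hdpos.le (by positivity) ?_
    exact mul_le_mul h1' h2' (by positivity) (le_trans (by positivity) h1')
  have s1 := Finset.sum_le_sum hlow
  have s2 := Finset.sum_le_sum hhigh
  rw [← Finset.mul_sum, Finset.sum_range_sub' fun j : ℕ => 1 / ((i : ℝ) + 1 - j)] at s1
  rw [← Finset.mul_sum, Finset.sum_range_sub fun j : ℕ => 1 / ((j : ℝ) + 1)] at s2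
  rw [← Finset.sum_range_add_sum_Ico _ (show i + 2 ≤ k by omega), Finset.sum_Ico_eq_sum_range,
    Finset.sum_range_succ, Finset.sum_range_succ] at key
  have e3 : 1 / (h i - h i) - 1 / (h (i + 1) - h i) = 1 / d := by
    rw [hdef, sub_self, div_zero, zero_sub, ← neg_sub (h i), one_div, one_div, inv_neg, neg_neg]
  have e4 : 1 / (h i - h (i + 1)) - 1 / (h (i + 1) - h (i + 1)) = 1 / d := by simp [hdef]
  rw [e3, e4] at key
  simp only [Nat.cast_zero, sub_zero, zero_add, add_sub_cancel_left, div_one] at s1 s2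
  have hk0 : (0 : ℝ) < k := by exact_mod_cast (show 0 < k by omega)
  have s2' : -(1 / d) ≤ 1 / d * (1 / (((k - (i + 2) : ℕ) : ℝ) + 1) - 1) := by
    have : 0 ≤ 1 / d * (1 / (((k - (i + 2) : ℕ) : ℝ) + 1)) := by positivity
    linarith
  have hfin : 1 / d * (1 / ((i : ℝ) + 1)) ≤ d := by linarith
  have : 1 / ((i : ℝ) + 1) ≤ d ^ 2 := by
    rw [one_div_mul_eq_div, div_le_iff₀ hdpos] at hfin
    linarith [sq d]
  refine le_trans (one_div_le_one_div_of_le (by positivity) ?_) this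
  exact_mod_cast hi.le

theorem gap (H : IsEquilibrium k h) {i j : ℕ} (hij : i < j) (hj : j < k) :
    1 / √k ≤ h i - h j := by
  obtain ⟨i0, hi0, hmin⟩ := Finset.exists_min_image (Finset.range (k - 1))
    (fun i => h i - h (i + 1)) ⟨0, by simp; omega⟩
  have hi0 := Finset.mem_range.1 hi0
  have h1 := H.min_gap (i := i0) (by omega)
    fun j hj => hmin j (Finset.mem_range.2 (by omega))
  have h2 : 1 / √k ≤ h i0 - h (i0 + 1) := by
    have hpos := sub_pos.2 (H.lt i0 (i0 + 1) (by omega) (by omega))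
    rw [← Real.sqrt_one, ← Real.sqrt_div zero_le_one]
    exact Real.sqrt_le_iff.2 ⟨hpos.le, h1⟩
  have h3 := mul_le_sub (h := h) (k := k) (h i0 - h (i0 + 1))
    (fun j hj => hmin j (Finset.mem_range.2 (by omega))) hij.le hj
  have h4 : (i : ℝ) + 1 ≤ j := by exact_mod_cast hij
  have h5 : 0 ≤ 1 / √(k : ℝ) := by positivity
  nlinarith

/-- The logarithmic derivative of the polynomial vanishing at the points satisfies a Riccati
equation. -/
theorem sq_sum (H : IsEquilibrium k h) {x : ℝ} (hx : ∀ i < k, x ≠ h i) :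
    (∑ j ∈ Finset.range k, 1 / (x - h j)) ^ 2 = ∑ j ∈ Finset.range k, 1 / (x - h j) ^ 2 +
      2 * (x * ∑ j ∈ Finset.range k, 1 / (x - h j) - k) := by
  have e : ∀ i ∈ Finset.range k, ∀ j ∈ Finset.range k, 1 / (x - h i) * (1 / (x - h j)) =
      (if i = j then 1 / (x - h i) ^ 2 else 0) +
        (1 / (x - h i) * (1 / (h i - h j)) + 1 / (x - h j) * (1 / (h j - h i))) := by
    intro i hi j hj
    have hi := Finset.mem_range.1 hi
    have hj := Finset.mem_range.1 hj
    have n1 := sub_ne_zero.2 (hx i hi)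
    have n2 := sub_ne_zero.2 (hx j hj)
    by_cases hij : i = j
    · subst hij
      simp [sq]
    · have n3 := sub_ne_zero.2 (H.ne hi hj hij)
      have n4 := sub_ne_zero.2 (H.ne hj hi (Ne.symm hij))
      rw [if_neg hij, zero_add, ← neg_sub (h i) (h j), one_div (-(h i - h j)), inv_neg]
      field_simp
      ring
  have e2 : ∑ i ∈ Finset.range k, ∑ j ∈ Finset.range k, 1 / (x - h i) * (1 / (h i - h j)) =
      x * ∑ j ∈ Finset.range k, 1 / (x - h j) - k := by
    have : (k : ℝ) = ∑ i ∈ Finset.range k, 1 := by simp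
    rw [this, Finset.mul_sum, ← Finset.sum_sub_distrib]
    refine Finset.sum_congr rfl fun i hi => ?_
    have hi := Finset.mem_range.1 hi
    have n1 := sub_ne_zero.2 (hx i hi)
    rw [← Finset.mul_sum, H.sum_eq hi]
    field_simp
    ring
  rw [sq, Finset.sum_mul_sum, Finset.sum_congr rfl fun i hi => Finset.sum_congr rfl (e i hi)]
  simp only [Finset.sum_add_distrib]
  rw [e2, Finset.sum_comm (s := Finset.range k) (t := Finset.range k)
    (f := fun i j => 1 / (x - h j) * (1 / (h j - h i))), e2]
  congr 1
  · refine Finset.sum_congr rfl fun i hi => ?_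
    rw [Finset.sum_ite_eq, if_pos hi]
  · ring

theorem edge (H : IsEquilibrium k h) (hk : 1 ≤ k) {w : ℝ} (hw : 1 ≤ w) (hwk : w ^ 6 = k) :
    √(2 * k) - (1 + Real.pi) / w ≤ h 0 := by
  by_contra hlt
  have hw0 : 0 < w := by linarith
  have hs : √(2 * k) = √2 * w ^ 3 := by
    rw [← hwk, Real.sqrt_mul zero_le_two, show w ^ 6 = (w ^ 3) ^ 2 by ring,
      Real.sqrt_sq (by positivity)]
  have h0 := H.nonneg hk
  set β := √(2 * k) - 1 / w with hβ
  have hgap : Real.pi / w < β - h 0 := by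
    rw [add_div] at hlt
    linarith
  set x := β - Real.pi / w with hxdef
  have hx0 : h 0 < x := by linarith
  set u : ℝ → ℝ := fun x => ∑ j ∈ Finset.range k, 1 / (x - h j) with hu
  have hne : ∀ y, h 0 < y → ∀ i < k, y ≠ h i := fun y hy i hi =>
    ((H.le_zero hi).trans_lt hy).ne'
  have hud : ∀ y, h 0 < y → HasDerivAt u (-∑ j ∈ Finset.range k, 1 / (y - h j) ^ 2) y := by
    intro y hy
    rw [← Finset.sum_neg_distrib]
    refine HasDerivAt.fun_sum fun j hj => ?_
    have := ((hasDerivAt_id' y).sub_const (h j)).fun_inv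
      (sub_ne_zero.2 (hne y hy j (Finset.mem_range.1 hj)))
    simpa [neg_div] using this
  set φ : ℝ → ℝ := fun y => Real.arctan ((u y - y) / w) + w * y with hφ
  have hφd : ∀ y, h 0 < y → HasDerivAt φ
      (1 / (1 + ((u y - y) / w) ^ 2) * ((-∑ j ∈ Finset.range k, 1 / (y - h j) ^ 2 - 1) / w) + w) y := by
    intro y hy
    have h1 := (((hud y hy).fun_sub (hasDerivAt_id' y)).div_const w).arctan
    have h2 := (hasDerivAt_id' y).const_mul w
    rw [mul_one] at h2
    exact h1.fun_add h2
  have hanti : AntitoneOn φ (Set.Icc x β) := by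
    refine antitoneOn_of_deriv_nonpos (convex_Icc x β)
      (fun y hy => (hφd y (hx0.trans_le hy.1)).continuousAt.continuousWithinAt) ?_ ?_
    · rw [interior_Icc]
      exact fun y hy => (hφd y (hx0.trans hy.1)).differentiableAt.differentiableWithinAt
    · rw [interior_Icc]
      intro y hy
      have hy0 := hx0.trans hy.1
      rw [(hφd y hy0).deriv]
      have hR := H.sq_sum (hne y hy0)
      rw [show ∑ j ∈ Finset.range k, 1 / (y - h j) = u y from rfl] at hR
      have hy2 : w ^ 2 ≤ 2 * k + 1 - y ^ 2 := by
        have h1 : y ^ 2 ≤ β ^ 2 := pow_le_pow_left₀ (by linarith) hy.2.le 2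
        have h2 : β ^ 2 = 2 * k - 2 * √2 * w ^ 2 + 1 / w ^ 2 := by
          rw [hβ, hs, ← hwk]
          field_simp
          rw [sub_sq, mul_pow, Real.sq_sqrt zero_le_two]
          ring
        have h3 : 1 / w ^ 2 ≤ 1 := by
          rw [div_le_one (by positivity)]
          nlinarith
        have h4 : 1 ≤ √2 := Real.one_le_sqrt.2 one_le_two
        nlinarith [sq_nonneg w]
      have hpos : 0 < 1 + ((u y - y) / w) ^ 2 := by positivity
      rw [div_mul_eq_mul_div, one_mul, ← le_neg_iff_add_nonpos_right, div_le_iff₀ hpos,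
        div_le_iff₀ hw0]
      have e : -w * (1 + ((u y - y) / w) ^ 2) * w = -(w ^ 2 + (u y - y) ^ 2) := by
        field_simp
      rw [e]
      nlinarith
  have hxβ : x ≤ β := by
    have : 0 < Real.pi / w := by positivity
    linarith
  have := hanti ⟨le_rfl, hxβ⟩ ⟨hxβ, le_rfl⟩ hxβ
  simp only [hφ] at this
  have h1 := Real.neg_pi_div_two_lt_arctan ((u β - β) / w)
  have h2 := Real.arctan_lt_pi_div_two ((u x - x) / w)
  have h3 : w * (β - x) = Real.pi := by
    rw [hxdef]
    field_simp
    ring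
  linarith

end IsEquilibrium

/-- The expectation of the part `i` of the shape of a random word. -/
noncomputable def avgPart (k n i : ℕ) : ℝ :=
  (∑ u : Fin n → Fin k, (gtTop k (wordPat u) i : ℝ)) / (k : ℝ) ^ n

theorem sum_avgPart (k n m : ℕ) :
    ∑ i ∈ Finset.range m, avgPart k n i = topSum k n m / (k : ℝ) ^ n := by
  rw [topSum, Finset.sum_comm, Finset.sum_div]
  rfl

theorem avg_affine (k n : ℕ) (hk : 1 ≤ k) (i j : ℕ) (p q : ℝ) :
    (∑ u : Fin n → Fin k, (p - ((gtTop k (wordPat u) i : ℝ) - gtTop k (wordPat u) j + k) * q)) /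
      (k : ℝ) ^ n = p - (avgPart k n i - avgPart k n j + k) * q := by
  have hpos : (0 : ℝ) < (k : ℝ) ^ n := by positivity
  rw [Finset.sum_sub_distrib, ← Finset.sum_mul, Finset.sum_add_distrib, Finset.sum_sub_distrib,
    avgPart, avgPart]
  simp
  field_simp

theorem two_div_sub_le {c x : ℝ} (hc : 0 < c) (hx : 0 < x) :
    2 / c - x * (1 / c ^ 2) ≤ 1 / x := by
  have : 1 / x - (2 / c - x * (1 / c ^ 2)) = (c - x) ^ 2 / (x * c ^ 2) := by
    field_simp
    ring
  have h : 0 ≤ (c - x) ^ 2 / (x * c ^ 2) := by positivity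
  linarith

theorem sum_avgPart_succ {k m : ℕ} (hk : 1 ≤ k) (hm : m ≤ k) (n : ℕ) (c : ℕ → ℕ → ℝ)
    (hc : ∀ i j, i < j → j < k → 0 < c i j) :
    ∑ i ∈ Finset.range m, avgPart k n i + (1 / k) * (m + ∑ i ∈ Finset.range m,
      ∑ j ∈ Finset.Ico m k,
        (2 / c i j - (avgPart k n i - avgPart k n j + k) * (1 / c i j ^ 2))) ≤
    ∑ i ∈ Finset.range m, avgPart k (n + 1) i := by
  have hk0 : (0 : ℝ) < k := by exact_mod_cast hk
  have hpos : (0 : ℝ) < (k : ℝ) ^ n := by positivity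
  have h1 : ∑ u : Fin n → Fin k, ((m : ℝ) + ∑ i ∈ Finset.range m, ∑ j ∈ Finset.Ico m k,
      (2 / c i j - ((gtTop k (wordPat u) i : ℝ) - gtTop k (wordPat u) j + k) *
        (1 / c i j ^ 2))) ≤
      ∑ u : Fin n → Fin k, ∑ i ∈ Finset.range m, addRate k (gtTop k (wordPat u)) i := by
    refine Finset.sum_le_sum fun u _ => ?_
    have hl := (wordPat_spec u).2.antitone
    refine le_trans (add_le_add le_rfl (Finset.sum_le_sum fun i hi => Finset.sum_le_sum
      fun j hj => ?_)) (le_sum_addRate hm hl)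
    have hi := Finset.mem_range.1 hi
    have hj := Finset.mem_Ico.1 hj
    refine two_div_sub_le (hc i j (by omega) hj.2) ?_
    have : (gtTop k (wordPat u) j : ℝ) ≤ gtTop k (wordPat u) i := by
      exact_mod_cast hl (show i ≤ j by omega)
    linarith
  have h2 : (∑ u : Fin n → Fin k, ((m : ℝ) + ∑ i ∈ Finset.range m, ∑ j ∈ Finset.Ico m k,
      (2 / c i j - ((gtTop k (wordPat u) i : ℝ) - gtTop k (wordPat u) j + k) *
        (1 / c i j ^ 2)))) / (k : ℝ) ^ n = m + ∑ i ∈ Finset.range m, ∑ j ∈ Finset.Ico m k,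
        (2 / c i j - (avgPart k n i - avgPart k n j + k) * (1 / c i j ^ 2)) := by
    rw [Finset.sum_add_distrib, add_div]
    congr 1
    · simp
      field_simp
    · rw [Finset.sum_comm, Finset.sum_div]
      refine Finset.sum_congr rfl fun i _ => ?_
      rw [Finset.sum_comm, Finset.sum_div]
      exact Finset.sum_congr rfl fun j _ => avg_affine k n hk i j _ _
  rw [sum_avgPart, sum_avgPart, topSum_succ k n m hm, ← h2]
  have e : (k * topSum k n m + ∑ u : Fin n → Fin k, ∑ i ∈ Finset.range m,
      addRate k (gtTop k (wordPat u)) i) / (k : ℝ) ^ (n + 1) = topSum k n m / (k : ℝ) ^ n +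
      1 / k * ((∑ u : Fin n → Fin k, ∑ i ∈ Finset.range m,
      addRate k (gtTop k (wordPat u)) i) / (k : ℝ) ^ n) := by
    rw [pow_succ]
    field_simp
  rw [e]
  gcongr

theorem sum_sub_mul_le (D a : ℕ → ℝ) (h0 : D 0 = 0) (m : ℕ) (hD : ∀ i ≤ m, 0 ≤ D i)
    (ha : ∀ i j, i < j → j < m → a i ≤ a j) (A : ℝ) (hA : ∀ i < m, a i ≤ A) :
    ∑ i ∈ Finset.range m, (D (i + 1) - D i) * a i ≤ D m * A := by
  induction m generalizing A with
  | zero => simp [h0]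
  | succ m ih =>
    have h1 := ih (fun i hi => hD i (by omega)) (fun i j hij hj => ha i j hij (by omega)) (a m)
      fun i hi => ha i m hi m.lt_succ_self
    have h2 := mul_le_mul_of_nonneg_left (hA m m.lt_succ_self) (hD (m + 1) le_rfl)
    rw [Finset.sum_range_succ]
    linarith

theorem le_sum_sub_mul (D b : ℕ → ℝ) (m k : ℕ) (hmk : m ≤ k) (hD : ∀ i ≤ k, 0 ≤ D i)
    (hb : ∀ i j, m ≤ i → i < j → j < k → b j ≤ b i) (B β : ℝ) (hB : ∀ j, m ≤ j → j < k → b j ≤ B)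
    (hβ : ∀ j, m ≤ j → j < k → β ≤ b j) (hβB : β ≤ B) :
    D k * β - D m * B ≤ ∑ j ∈ Finset.Ico m k, (D (j + 1) - D j) * b j := by
  induction k, hmk using Nat.le_induction generalizing β with
  | base =>
    have := mul_le_mul_of_nonneg_left hβB (hD m le_rfl)
    simp
    linarith
  | succ k hmk ih =>
    have h1 := ih (fun i hi => hD i (by omega)) (fun i j hi hij hj => hb i j hi hij (by omega))
      (b k) (fun j hj hjk => hB j hj (by omega)) (fun j hj hjk => hb j k hj hjk k.lt_succ_self)
      (hB k hmk k.lt_succ_self)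
    have h2 := mul_le_mul_of_nonneg_left (hβ k hmk k.lt_succ_self) (hD (k + 1) le_rfl)
    rw [Finset.sum_Ico_succ_top hmk]
    linarith

/-- The square root growth governing the comparison dynamics. -/
noncomputable def growth (k n : ℕ) : ℝ := √((k * √k) ^ 2 + 2 * n / k)

theorem growth_zero (k : ℕ) : growth k 0 = k * √k := by
  rw [growth, Nat.cast_zero, mul_zero, zero_div, add_zero, Real.sqrt_sq (by positivity)]

theorem le_growth (k n : ℕ) : k * √k ≤ growth k n :=
  Real.le_sqrt_of_sq_le (by have : (0 : ℝ) ≤ 2 * n / k := by positivity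
                            linarith)

theorem growth_succ_sub_le {k : ℕ} (hk : 1 ≤ k) (n : ℕ) :
    growth k (n + 1) - growth k n ≤ 1 / (k * growth k n) := by
  have hk0 : (0 : ℝ) < k := by exact_mod_cast hk
  have h0 : 0 < growth k n := lt_of_lt_of_le (by positivity) (le_growth k n)
  have e1 : growth k n ^ 2 = (k * √k) ^ 2 + 2 * n / k := Real.sq_sqrt (by positivity)
  have e2 : growth k (n + 1) ^ 2 = (k * √k) ^ 2 + 2 * (n + 1 : ℕ) / k :=
    Real.sq_sqrt (by positivity)
  have hle : growth k (n + 1) ≤ growth k n + 1 / (k * growth k n) := by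
    refine abs_le_of_sq_le_sq' ?_ (by positivity) |>.2
    have e3 : (growth k n + 1 / (k * growth k n)) ^ 2 =
        growth k n ^ 2 + 2 / k + (1 / (k * growth k n)) ^ 2 := by
      field_simp
      ring
    rw [e3, e1, e2]
    push_cast
    have : 2 * ((n : ℝ) + 1) / k = 2 * n / k + 2 / k := by ring
    have := sq_nonneg (1 / (k * growth k n))
    linarith
  linarith

theorem comparison {k : ℕ} (hk : 1 ≤ k) {h : ℕ → ℝ} (H : IsEquilibrium k h) (n : ℕ) :
    ∀ m ≤ k, ∑ i ∈ Finset.range m, ((n : ℝ) / k + (growth k n - growth k 0) * h i) ≤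
      ∑ i ∈ Finset.range m, avgPart k n i := by
  have hk0 : (0 : ℝ) < k := by exact_mod_cast hk
  induction n with
  | zero =>
    intro m hm
    rw [sum_avgPart, topSum_zero]
    simp
  | succ n ih =>
    intro m hm
    set a := growth k n - growth k 0 with ha
    have ha0 : 0 ≤ a := by
      rw [ha, growth_zero]
      exact sub_nonneg.2 (le_growth k n)
    have hb0 : 0 < growth k n := lt_of_lt_of_le (by positivity) (le_growth k n)
    set c : ℕ → ℕ → ℝ := fun i j => a * (h i - h j) + k with hc
    have hck : ∀ i j, i < j → j < k → k ≤ c i j := by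
      intro i j hij hj
      have := mul_nonneg ha0 (sub_pos.2 (H.lt i j hij hj)).le
      simp only [hc]
      linarith
    set D : ℕ → ℝ := fun m => ∑ i ∈ Finset.range m, (avgPart k n i - (n / k + a * h i)) with hD
    have hDnn : ∀ i ≤ k, 0 ≤ D i := by
      intro i hi
      simp only [hD]
      rw [Finset.sum_sub_distrib]
      exact sub_nonneg.2 (ih i hi)
    have hDs : ∀ i, D (i + 1) - D i = avgPart k n i - (n / k + a * h i) := by
      intro i
      simp only [hD, Finset.sum_range_succ, add_sub_cancel_left]
    have hstep := sum_avgPart_succ hk hm n c fun i j hij hj => hk0.trans_le (hck i j hij hj)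
    have hterm : ∀ i ∈ Finset.range m, ∀ j ∈ Finset.Ico m k,
        2 / c i j - (avgPart k n i - avgPart k n j + k) * (1 / c i j ^ 2) =
        1 / c i j - ((D (i + 1) - D i) * (1 / c i j ^ 2) - (D (j + 1) - D j) * (1 / c i j ^ 2)) := by
      intro i hi j hj
      have hi := Finset.mem_range.1 hi
      have hj := Finset.mem_Ico.1 hj
      have h1 : c i j ≠ 0 := (hk0.trans_le (hck i j (by omega) hj.2)).ne'
      have h2 : avgPart k n i - avgPart k n j + k =
          c i j + ((D (i + 1) - D i) - (D (j + 1) - D j)) := by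
        rw [hDs, hDs]
        simp only [hc]
        ring
      rw [h2]
      field_simp
      ring
    rw [Finset.sum_congr rfl fun i hi => Finset.sum_congr rfl (hterm i hi)] at hstep
    simp only [Finset.sum_sub_distrib] at hstep
    rw [Finset.sum_comm (f := fun i j => (D (j + 1) - D j) * (1 / c i j ^ 2))] at hstep
    simp only [← Finset.mul_sum] at hstep
    have hq : ∀ i j, i < j → j < k → 1 / c i j ^ 2 ≤ 1 / (k : ℝ) ^ 2 := fun i j hij hj =>
      one_div_le_one_div_of_le (by positivity) (pow_le_pow_left₀ hk0.le (hck i j hij hj) 2)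
    have hmono : ∀ i j i' j', i < j → j < k → i' < j' → j' < k → i ≤ i' → j' ≤ j →
        1 / c i j ^ 2 ≤ 1 / c i' j' ^ 2 := by
      intro i j i' j' hij hj hij' hj' hi hjj
      have hle : ∀ p q, p ≤ q → q < k → h q ≤ h p := by
        intro p q hpq hq
        rcases hpq.eq_or_lt with rfl | hpq
        · exact le_rfl
        · exact (H.lt p q hpq hq).le
      have h1 := hck i' j' hij' hj'
      refine one_div_le_one_div_of_le (pow_pos (by linarith) 2) (pow_le_pow_left₀ (by linarith) ?_ 2)
      have h2 := hle i i' hi (by omega)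
      have h3 := hle j' j hjj hj
      have := mul_le_mul_of_nonneg_left (show h i' - h j' ≤ h i - h j by linarith) ha0
      simp only [hc]
      linarith
    have hA := sum_sub_mul_le D (fun i => ∑ j ∈ Finset.Ico m k, 1 / c i j ^ 2) (by simp [hD]) m
      (fun i hi => hDnn i (by omega))
      (fun i i' hi hi' => Finset.sum_le_sum fun j hj => by
        have hj := Finset.mem_Ico.1 hj
        exact hmono i j i' j (by omega) hj.2 (by omega) hj.2 hi.le le_rfl)
      (((k : ℝ) - m) * (1 / (k : ℝ) ^ 2)) (fun i hi => by
        refine (Finset.sum_le_card_nsmul _ _ (1 / (k : ℝ) ^ 2) fun j hj => ?_).trans (le_of_eq ?_)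
        · have hj := Finset.mem_Ico.1 hj
          exact hq i j (by omega) hj.2
        · rw [Nat.card_Ico, nsmul_eq_mul, Nat.cast_sub hm])
    have hB := le_sum_sub_mul D (fun j => ∑ i ∈ Finset.range m, 1 / c i j ^ 2) m k hm hDnn
      (fun j j' hmj hj hj' => Finset.sum_le_sum fun i hi => by
        have hi := Finset.mem_range.1 hi
        exact hmono i j' i j (by omega) hj' (by omega) (by omega) le_rfl hj.le)
      ((m : ℝ) * (1 / (k : ℝ) ^ 2)) 0 (fun j hmj hj => by
        refine (Finset.sum_le_card_nsmul _ _ (1 / (k : ℝ) ^ 2) fun i hi => ?_).trans (le_of_eq ?_)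
        · have hi := Finset.mem_range.1 hi
          exact hq i j (by omega) hj
        · rw [Finset.card_range, nsmul_eq_mul])
      (fun j hmj hj => Finset.sum_nonneg fun i _ => by positivity) (by positivity)
    have hloss : D m * (((k : ℝ) - m) * (1 / (k : ℝ) ^ 2)) + D m * ((m : ℝ) * (1 / (k : ℝ) ^ 2)) ≤
        k * D m := by
      have e : D m * (((k : ℝ) - m) * (1 / (k : ℝ) ^ 2)) + D m * ((m : ℝ) * (1 / (k : ℝ) ^ 2)) =
          (1 / k) * D m := by
        field_simp
        ring
      rw [e]
      refine mul_le_mul_of_nonneg_right ?_ (hDnn m hm)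
      have : (1 : ℝ) ≤ k := by exact_mod_cast hk
      exact ((div_le_one hk0).2 this).trans this
    have hgrow : (growth k (n + 1) - growth k n) * ∑ i ∈ Finset.range m, h i ≤
        (1 / k) * ∑ i ∈ Finset.range m, ∑ j ∈ Finset.Ico m k, 1 / c i j := by
      rw [← H.sum_cross hm, Finset.mul_sum, Finset.mul_sum]
      refine Finset.sum_le_sum fun i hi => ?_
      rw [Finset.mul_sum, Finset.mul_sum]
      refine Finset.sum_le_sum fun j hj => ?_
      have hi := Finset.mem_range.1 hi
      have hj := Finset.mem_Ico.1 hj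
      have hg0 := sub_pos.2 (H.lt i j (by omega) hj.2)
      have hg := H.gap (i := i) (j := j) (by omega) hj.2
      refine (mul_le_mul_of_nonneg_right (growth_succ_sub_le hk n)
        (one_div_nonneg.2 hg0.le)).trans ?_
      rw [← one_div_mul_one_div, mul_assoc, one_div_mul_one_div]
      refine mul_le_mul_of_nonneg_left (one_div_le_one_div_of_le
        (hk0.trans_le (hck i j (by omega) hj.2)) ?_) (by positivity)
      simp only [hc, ha]
      have hsk : 0 < √(k : ℝ) := Real.sqrt_pos.2 hk0
      have h1 : (k : ℝ) ≤ growth k 0 * (h i - h j) := by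
        rw [growth_zero]
        refine le_trans (le_of_eq ?_) (mul_le_mul_of_nonneg_left hg (by positivity))
        field_simp
      linarith
    have hYD : ∑ i ∈ Finset.range m, avgPart k n i = D m +
        ∑ i ∈ Finset.range m, ((n : ℝ) / k + a * h i) := by
      simp only [hD, Finset.sum_sub_distrib]
      ring
    have hY : ∑ i ∈ Finset.range m,
        (((n + 1 : ℕ) : ℝ) / k + (growth k (n + 1) - growth k 0) * h i) =
        ∑ i ∈ Finset.range m, ((n : ℝ) / k + a * h i) + (1 / k) * m +
        (growth k (n + 1) - growth k n) * ∑ i ∈ Finset.range m, h i := by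
      simp only [Finset.sum_add_distrib, ← Finset.mul_sum, Finset.sum_const, Finset.card_range,
        nsmul_eq_mul, ha]
      push_cast
      ring
    rw [hY]
    refine le_trans ?_ hstep
    rw [hYD]
    have hk1 : (1 / (k : ℝ)) * (k * D m) = D m := by field_simp
    have hfinal : (1 / (k : ℝ)) * (∑ i ∈ Finset.range m, (D (i + 1) - D i) *
        ∑ j ∈ Finset.Ico m k, 1 / c i j ^ 2 - ∑ j ∈ Finset.Ico m k, (D (j + 1) - D j) *
        ∑ i ∈ Finset.range m, 1 / c i j ^ 2) ≤ D m := by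
      rw [← hk1]
      refine mul_le_mul_of_nonneg_left ?_ (one_div_nonneg.2 hk0.le)
      simp only [mul_zero, zero_sub] at hB
      linarith
    rw [mul_add, mul_sub]
    linarith

theorem le_expLNDS {k : ℕ} (hk : 1 ≤ k) (n : ℕ) {w : ℝ} (hw : 1 ≤ w) (hwk : w ^ 6 = k) :
    n / k + 2 * √n - 20 * √n / w ^ 4 - 20 * (k : ℝ) ^ 2 ≤ expLNDS k n := by
  have hk0 : (0 : ℝ) < k := by exact_mod_cast hk
  have hw0 : 0 < w := by linarith
  obtain ⟨h, H⟩ := exists_equilibrium k hk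
  have h1 := comparison hk H n 1 hk
  rw [sum_avgPart, ← expLNDS_eq_topSum k n hk, Finset.sum_range_one, growth_zero] at h1
  refine le_trans ?_ h1
  have hsk : √(k : ℝ) = w ^ 3 := by
    rw [← hwk, show w ^ 6 = (w ^ 3) ^ 2 by ring, Real.sqrt_sq (by positivity)]
  have hs2k : √(2 * (k : ℝ)) = √2 * w ^ 3 := by rw [Real.sqrt_mul zero_le_two, hsk]
  have hs2n : √(2 * (n : ℝ) / k) = √2 * √n / w ^ 3 := by
    rw [Real.sqrt_div (by positivity), Real.sqrt_mul zero_le_two, hsk]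
  have ha0 : 0 ≤ growth k n - k * √k := sub_nonneg.2 (le_growth k n)
  have ha1 : √2 * √n / w ^ 3 - k * √k ≤ growth k n - k * √k := by
    rw [← hs2n]
    refine sub_le_sub_right (Real.sqrt_le_sqrt ?_) _
    linarith [sq_nonneg (k * √k)]
  have ha2 : growth k n - k * √k ≤ √2 * √n / w ^ 3 := by
    rw [← hs2n, sub_le_iff_le_add', growth]
    have h2 : √(2 * (n : ℝ) / k) ^ 2 = 2 * n / k := Real.sq_sqrt (by positivity)
    have h3 : 0 ≤ k * √(k : ℝ) * √(2 * (n : ℝ) / k) := by positivity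
    refine Real.sqrt_le_iff.2 ⟨by positivity, ?_⟩
    rw [add_sq, h2]
    linarith
  have hedge := H.edge hk hw hwk
  rw [hs2k] at hedge
  set a := growth k n - k * √k with ha
  have hs2 : √2 ^ 2 = 2 := Real.sq_sqrt zero_le_two
  have hs2le : √2 ≤ 2 := by
    rw [Real.sqrt_le_left (by norm_num)]
    norm_num
  have m1 := mul_le_mul_of_nonneg_left hedge ha0
  have m2 := mul_le_mul_of_nonneg_left ha1 (show 0 ≤ √2 * w ^ 3 by positivity)
  have m3 := mul_le_mul_of_nonneg_left ha2 (show 0 ≤ (1 + Real.pi) / w by positivity)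
  have e2 : √2 * w ^ 3 * (√2 * √n / w ^ 3 - k * √k) = 2 * √n - √2 * (k : ℝ) ^ 2 := by
    rw [hsk, ← hwk]
    field_simp
    linear_combination √n * hs2
  have e3 : (1 + Real.pi) / w * (√2 * √n / w ^ 3) = ((1 + Real.pi) * √2) * (√n / w ^ 4) := by
    field_simp
  have b1 : (1 + Real.pi) * √2 ≤ 20 := by nlinarith [Real.pi_le_four, Real.pi_pos]
  have b2 := mul_le_mul_of_nonneg_right b1 (show 0 ≤ √n / w ^ 4 by positivity)
  have b3 := mul_le_mul_of_nonneg_right hs2le (sq_nonneg (k : ℝ))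
  have e4 : 20 * √n / w ^ 4 = 20 * (√n / w ^ 4) := by ring
  rw [e2] at m2
  rw [e3] at m3
  rw [e4]
  linarith [sq_nonneg (k : ℝ)]

/-- There is an absolute constant `C > 0` such that for all integers
`k ≥ 1` and `n ≥ 2`, a uniformly random word `w ~ [k]^n` satisfies
`|E[LNDS(w)] − n/k − 2√n| ≤ 2√n · C · (k^{-2/3} + (k² + k log n)/n^{1/2})`. -/
theorem stmt11 :
    ∃ C : ℝ, 0 < C ∧
      ∀ k n : ℕ, 1 ≤ k → 2 ≤ n →
        |expLNDS k n - n / k - 2 * Real.sqrt n| ≤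
          2 * Real.sqrt n * C *
            ((k : ℝ) ^ (-(2 : ℝ) / 3) + ((k : ℝ) ^ 2 + k * Real.log n) / Real.sqrt n) := by
  refine ⟨10, by norm_num, fun k n hk hn => ?_⟩
  have hk1 : (1 : ℝ) ≤ k := by exact_mod_cast hk
  have hk0 : (0 : ℝ) < k := by linarith
  obtain ⟨w, hw⟩ : ∃ w, w = (k : ℝ) ^ (1 / 6 : ℝ) := ⟨_, rfl⟩
  have hw1 : 1 ≤ w := hw ▸ Real.one_le_rpow hk1 (by norm_num)
  have hwk : w ^ 6 = k := by
    rw [hw, ← Real.rpow_natCast, ← Real.rpow_mul hk0.le]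
    norm_num
  have hw4 : (k : ℝ) ^ (-(2 : ℝ) / 3) = 1 / w ^ 4 := by
    rw [hw, ← Real.rpow_natCast, ← Real.rpow_mul hk0.le, one_div, ← Real.rpow_neg hk0.le]
    norm_num
  have hlow := le_expLNDS hk n hw1 hwk
  have hup := expLNDS_le k n hk (by omega)
  have hn0 : 0 < √(n : ℝ) := Real.sqrt_pos.2 (by exact_mod_cast (show 0 < n by omega))
  have hlog : 0 ≤ (k : ℝ) * Real.log n := mul_nonneg hk0.le (Real.log_natCast_nonneg n)
  have e : 2 * √n * 10 * (1 / w ^ 4 + ((k : ℝ) ^ 2 + k * Real.log n) / √n) =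
      20 * √n / w ^ 4 + 20 * (k : ℝ) ^ 2 + 20 * (k * Real.log n) := by
    field_simp
    ring
  have hnn : 0 ≤ 20 * √n / w ^ 4 := by positivity
  rw [hw4, e, abs_le]
  constructor
  · linarith
  · linarith [sq_nonneg (k : ℝ)]
end

section
/- Let d ≥ 0 and k ≥ 1 be integers, let w and w' be any two words over the alphabet {0,1,...,d}, and let 𝒜 = {A_1,...,A_k} be any partition of {0,1,...,d} into k (not necessarily non-empty) parts. Writing each part A as a word by listing its elements in decreasing order, the average over the k parts satisfies (1/k)·Σ_{A ∈ 𝒜} LNDS(wAw') ≥ LNDS(ww') + 1/k. -/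
theorem bddAbove_chain_sublist_lengths {α : Type*} [LinearOrder α] (w : List α) :
    BddAbove {n | ∃ u : List α, u.Sublist w ∧ u.IsChain (· ≤ ·) ∧ u.length = n} :=
  ⟨w.length, by rintro n ⟨u, hu, -, rfl⟩; exact hu.length_le⟩

theorem length_le_LNDS {α : Type*} [LinearOrder α] {u w : List α} (hu : u.Sublist w)
    (hc : u.IsChain (· ≤ ·)) : u.length ≤ LNDS w :=
  le_csSup (bddAbove_chain_sublist_lengths w) ⟨u, hu, hc, rfl⟩

theorem exists_length_eq_LNDS {α : Type*} [LinearOrder α] (w : List α) :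
    ∃ u : List α, u.Sublist w ∧ u.IsChain (· ≤ ·) ∧ u.length = LNDS w :=
  Nat.sSup_mem (s := {n | ∃ u : List α, u.Sublist w ∧ u.IsChain (· ≤ ·) ∧ u.length = n})
    ⟨0, [], List.nil_sublist w, List.isChain_nil, rfl⟩
    (bddAbove_chain_sublist_lengths w)

theorem LNDS_le_of_sublist {α : Type*} [LinearOrder α] {v w : List α} (h : v.Sublist w) :
    LNDS v ≤ LNDS w := by
  obtain ⟨u, hu, hc, hl⟩ := exists_length_eq_LNDS v
  exact hl ▸ length_le_LNDS (hu.trans h) hc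

/-- Some letter can be inserted between two words so that the longest non-decreasing
subsequence grows. -/
theorem exists_LNDS_append_lt (d : ℕ) (w w' : List ℕ) (hw : ∀ s ∈ w, s ≤ d) :
    ∃ a ≤ d, ∀ v : List ℕ, a ∈ v → LNDS (w ++ w') + 1 ≤ LNDS (w ++ v ++ w') := by
  obtain ⟨u, hu, hc, hl⟩ := exists_length_eq_LNDS (w ++ w')
  obtain ⟨u₁, u₂, rfl, h₁, h₂⟩ := List.sublist_append_iff.1 hu
  obtain ⟨p₁, p₂, p₁₂⟩ := List.pairwise_append.1 (List.isChain_iff_pairwise.1 hc)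
  obtain ⟨a, had, ha₁, ha₂⟩ : ∃ a ≤ d, (∀ x ∈ u₁, x ≤ a) ∧ ∀ y ∈ u₂, a ≤ y := by
    rcases List.eq_nil_or_concat u₁ with rfl | ⟨t, a, rfl⟩
    · exact ⟨0, Nat.zero_le d, by simp, by simp⟩
    · refine ⟨a, hw a (h₁.subset (by simp)), fun x hx => ?_, fun y hy => p₁₂ a (by simp) y hy⟩
      rw [List.concat_eq_append] at p₁ hx
      rcases List.mem_append.1 hx with hx | hx
      · exact (List.pairwise_append.1 p₁).2.2 x hx a (by simp)
      · exact (List.mem_singleton.1 hx).le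
  refine ⟨a, had, fun v hv => ?_⟩
  have hsub : (u₁ ++ [a] ++ u₂).Sublist (w ++ v ++ w') :=
    (h₁.append (List.singleton_sublist.2 hv)).append h₂
  have hchain : (u₁ ++ [a] ++ u₂).IsChain (· ≤ ·) := by
    rw [List.isChain_iff_pairwise, List.pairwise_append, List.pairwise_append]
    refine ⟨⟨p₁, by simp, by simpa using ha₁⟩, p₂, fun x hx y hy => ?_⟩
    rcases List.mem_append.1 hx with hx | hx
    · exact p₁₂ x hx y hy
    · exact List.mem_singleton.1 hx ▸ ha₂ y hy
  have := length_le_LNDS hsub hchain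
  simp only [List.length_append, List.length_singleton] at this hl
  omega

/-- Let `d ≥ 0`, `k ≥ 1`, let `w, w'` be words over `{0, 1, …, d}` and let
`𝒜 = {A_1, …, A_k}` be a partition of `{0, 1, …, d}` into `k` (possibly empty) parts.
Writing each part `A` as a word by listing its elements in decreasing order,
`(1/k) Σ_{A ∈ 𝒜} LNDS(w A w') ≥ LNDS(w w') + 1/k`. -/
theorem stmt13 (d k : ℕ) (hk : 1 ≤ k) (w w' : List ℕ)
    (hw : ∀ s ∈ w, s ≤ d) (hw' : ∀ s ∈ w', s ≤ d)
    (A : Fin k → Finset ℕ)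
    (hdisj : ∀ i j, i ≠ j → Disjoint (A i) (A j))
    (hcover : Finset.univ.biUnion A = Finset.range (d + 1)) :
    (LNDS (w ++ w') : ℝ) + 1 / k ≤
      (1 / k : ℝ) * ∑ i : Fin k, (LNDS (w ++ ((A i).sort (· ≤ ·)).reverse ++ w') : ℝ) := by
  obtain ⟨a, had, ha⟩ := exists_LNDS_append_lt d w w' hw
  have hmem : a ∈ Finset.univ.biUnion A := by
    rw [hcover, Finset.mem_range]; omega
  obtain ⟨i, -, hi⟩ := Finset.mem_biUnion.1 hmem
  have hsum : ∑ j : Fin k, (LNDS (w ++ w') + if j = i then 1 else 0) ≤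
      ∑ j : Fin k, LNDS (w ++ ((A j).sort (· ≤ ·)).reverse ++ w') := by
    refine Finset.sum_le_sum fun j _ => ?_
    split_ifs with hj
    · subst hj
      exact ha _ (List.mem_reverse.2 ((Finset.mem_sort _).2 hi))
    · exact LNDS_le_of_sublist ((List.sublist_append_left w _).append_right w')
  rw [Finset.sum_add_distrib] at hsum
  simp only [Finset.sum_const, Finset.card_univ, Fintype.card_fin, smul_eq_mul,
    Finset.sum_ite_eq', Finset.mem_univ, if_true] at hsum
  have hsum' : (k : ℝ) * LNDS (w ++ w') + 1 ≤
      ∑ j : Fin k, (LNDS (w ++ ((A j).sort (· ≤ ·)).reverse ++ w') : ℝ) := by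
    exact_mod_cast hsum
  have hk0 : (0 : ℝ) < k := by exact_mod_cast hk
  calc (LNDS (w ++ w') : ℝ) + 1 / k = (1 / k : ℝ) * (k * LNDS (w ++ w') + 1) := by
        field_simp
    _ ≤ _ := by gcongr
end

section
/- Let A ≥ 0 be a real number. There exists n_0 = n_0(A) such that the following holds. Let s_0 ≤ s_1 ≤ s_2 ≤ ⋯ be a non-decreasing sequence of reals satisfying s_m − s_{m−1} ≤ m^A for all m ≥ 1, and for λ > 0 let s̃_λ denote the random variable s_{N} where N ~ Pois(λ). Then for every integer n ≥ n_0, E[s̃_{λ⁻}] − 4/n^A ≤ s_n ≤ E[s̃_{λ⁺}] + 4/n^A, where λ^{±} = n ± (A+1)·√(2n·log n). -/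
/-- `E[s_N]` for `N ~ Pois(lam)`: the Poissonization of the sequence `s`. -/
noncomputable def poiExp (s : ℕ → ℝ) (lam : ℝ) : ℝ :=
  ∑' m : ℕ, (Real.exp (-lam) * lam ^ m / (m.factorial : ℝ)) * s m

theorem hasSum_poisson_exp_mul (lam t : ℝ) (n : ℕ) :
    HasSum (fun m : ℕ => (Real.exp (-lam) * lam ^ m / (m.factorial : ℝ)) *
      Real.exp (t * ((m : ℝ) - n))) (Real.exp (lam * (Real.exp t - 1) - t * n)) := by
  have h : HasSum (fun m : ℕ => (lam * Real.exp t) ^ m / (m.factorial : ℝ))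
      (Real.exp (lam * Real.exp t)) := by
    rw [Real.exp_eq_exp_ℝ]
    exact NormedSpace.expSeries_div_hasSum_exp (lam * NormedSpace.exp t)
  have hval : Real.exp (-lam - t * n) * Real.exp (lam * Real.exp t) =
      Real.exp (lam * (Real.exp t - 1) - t * n) := by
    rw [← Real.exp_add]
    ring_nf
  rw [← hval]
  refine (congrArg (fun f => HasSum f _) (funext fun m => ?_)).mpr (h.mul_left (Real.exp (-lam - t * n)))
  rw [mul_pow, ← Real.exp_nat_mul, mul_sub, Real.exp_sub, Real.exp_sub, mul_comm t m]
  ring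

theorem sub_le_mul_rpow_of_increment_le {A : ℝ} (hA : 0 ≤ A) {s : ℕ → ℝ}
    (hs : ∀ m : ℕ, 1 ≤ m → s m - s (m - 1) ≤ (m : ℝ) ^ A) {n m : ℕ} (hnm : n ≤ m) :
    s m - s n ≤ ((m : ℝ) - n) * (m : ℝ) ^ A := by
  induction m, hnm using Nat.le_induction with
  | base => simp
  | succ m hnm ih =>
    have h1 := hs (m + 1) (by omega)
    rw [Nat.add_sub_cancel] at h1
    have h2 : (m : ℝ) ^ A ≤ ((m + 1 : ℕ) : ℝ) ^ A :=
      Real.rpow_le_rpow (by positivity) (by push_cast; linarith) hA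
    have h3 : (n : ℝ) ≤ m := by exact_mod_cast hnm
    have h4 := mul_le_mul_of_nonneg_left h2 (sub_nonneg.2 h3)
    have h5 : (((m + 1 : ℕ) : ℝ) - n) = (m - n) + 1 := by push_cast; ring
    rw [h5]
    linarith

theorem summable_poisson_mul {A : ℝ} (hA : 0 ≤ A) {s : ℕ → ℝ} (hmono : Monotone s)
    (hs : ∀ m : ℕ, 1 ≤ m → s m - s (m - 1) ≤ (m : ℝ) ^ A) {lam : ℝ} (hlam : 0 ≤ lam) :
    Summable fun m : ℕ => (Real.exp (-lam) * lam ^ m / (m.factorial : ℝ)) * s m := by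
  have hexp : ∀ t : ℝ, Summable fun m : ℕ =>
      (Real.exp (-lam) * lam ^ m / (m.factorial : ℝ)) * Real.exp (t * m) := fun t => by
    simpa using (hasSum_poisson_exp_mul lam t 0).summable
  have hbound : ∀ m : ℕ, s m - s 0 ≤ Real.exp ((A + 1) * m) := fun m => by
    have h1 := sub_le_mul_rpow_of_increment_le hA hs (Nat.zero_le m)
    have h2 : (m : ℝ) ≤ Real.exp m := by linarith [Real.add_one_le_exp (m : ℝ)]
    have h3 : (m : ℝ) ^ A ≤ Real.exp m ^ A := Real.rpow_le_rpow (by positivity) h2 hA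
    have h4 := mul_le_mul h2 h3 (by positivity) (by positivity)
    rw [← Real.exp_mul, ← Real.exp_add] at h4
    rw [Nat.cast_zero, sub_zero] at h1
    rw [show (A + 1) * (m : ℝ) = m + m * A by ring]
    exact h1.trans h4
  have hdiff : Summable fun m : ℕ =>
      (Real.exp (-lam) * lam ^ m / (m.factorial : ℝ)) * (s m - s 0) :=
    Summable.of_nonneg_of_le
      (fun m => mul_nonneg (by positivity) (sub_nonneg.2 (hmono (Nat.zero_le m))))
      (fun m => mul_le_mul_of_nonneg_left (hbound m) (by positivity)) (hexp (A + 1))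
  have hconst := (hexp 0).mul_right (s 0)
  refine (hdiff.add hconst).congr fun m => ?_
  simp only [zero_mul, Real.exp_zero]
  ring

/-- Chernoff-type bound for the expectation of an affine image of `s` under a Poisson law. -/
theorem mul_poiExp_sub_le {s : ℕ → ℝ} {lam : ℝ} (hlam : 0 ≤ lam)
    (hsum : Summable fun m : ℕ => (Real.exp (-lam) * lam ^ m / (m.factorial : ℝ)) * s m)
    {c K t : ℝ} {n : ℕ} (h : ∀ m : ℕ, c * (s m - s n) ≤ K * Real.exp (t * ((m : ℝ) - n))) :
    c * (poiExp s lam - s n) ≤ K * Real.exp (lam * (Real.exp t - 1) - t * n) := by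
  have hone : HasSum (fun m : ℕ => Real.exp (-lam) * lam ^ m / (m.factorial : ℝ)) 1 := by
    simpa using hasSum_poisson_exp_mul lam 0 n
  have hL := (hsum.hasSum.sub (hone.mul_right (s n))).mul_left c
  have hR := (hasSum_poisson_exp_mul lam t n).mul_left K
  rw [one_mul] at hL
  refine hasSum_le (fun m => ?_) hL hR
  have hp : 0 ≤ Real.exp (-lam) * lam ^ m / (m.factorial : ℝ) := by positivity
  have := mul_le_mul_of_nonneg_left (h m) hp
  linarith

theorem exp_le_cubic {t : ℝ} (ht : |t| ≤ 1) :
    Real.exp t ≤ 1 + t + t ^ 2 / 2 + |t| ^ 3 * (2 / 9) := by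
  have h := Real.exp_bound ht (n := 3) (by norm_num)
  have h' := (abs_le.1 h).2
  norm_num [Finset.sum_range_succ, Nat.factorial] at h'
  linarith

theorem eventually_deviation_bounds (A : ℝ) (hA : 0 ≤ A) :
    ∀ᶠ n : ℕ in Filter.atTop, 3 ≤ n ∧
      A + 1 ≤ (A + 1) * Real.sqrt (2 * n * Real.log n) ∧
      ((A + 1) * Real.sqrt (2 * n * Real.log n)) ^ 3 ≤ (n : ℝ) ^ 2 := by
  have ho := (Real.isLittleO_pow_log_id_atTop (n := 3)).comp_tendsto tendsto_natCast_atTop_atTop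
  have hc : (0 : ℝ) < 1 / (8 * (A + 1) ^ 6) := by positivity
  filter_upwards [ho.bound hc, Filter.eventually_ge_atTop 3] with n hn h3
  have h3' : (3 : ℝ) ≤ n := by exact_mod_cast h3
  have hlog : 1 ≤ Real.log n := by
    rw [Real.le_log_iff_exp_le (by linarith)]
    linarith [Real.exp_one_lt_d9]
  refine ⟨h3, ?_, ?_⟩
  · have : 1 ≤ Real.sqrt (2 * n * Real.log n) := by
      rw [Real.one_le_sqrt]
      nlinarith
    nlinarith
  · refine (pow_le_pow_iff_left₀ (by positivity) (by positivity) two_ne_zero).1 ?_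
    have hsq : Real.sqrt (2 * n * Real.log n) ^ 2 = 2 * n * Real.log n :=
      Real.sq_sqrt (by positivity)
    have h6 : (((A + 1) * Real.sqrt (2 * n * Real.log n)) ^ 3) ^ 2 =
        (A + 1) ^ 6 * (Real.sqrt (2 * n * Real.log n) ^ 2) ^ 3 := by ring
    rw [h6, hsq]
    simp only [Function.comp_apply, id, Real.norm_eq_abs] at hn
    rw [abs_of_nonneg (by positivity), abs_of_nonneg (by positivity), one_div,
      inv_mul_eq_div, le_div_iff₀ (by positivity)] at hn
    have := mul_le_mul_of_nonneg_left hn (show (0 : ℝ) ≤ (n : ℝ) ^ 3 by positivity)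
    linarith

theorem rpow_mul_exp_le {A : ℝ} {n : ℕ} (hn : 1 ≤ n) {e : ℝ}
    (he : e ≤ 1 - (A + 1) ^ 2 * Real.log n) :
    (n : ℝ) ^ A * n * Real.exp e ≤ 4 / (n : ℝ) ^ A := by
  have hn' : (1 : ℝ) ≤ n := by exact_mod_cast hn
  have hpos : (0 : ℝ) < n := by linarith
  have hlog : 0 ≤ Real.log n := Real.log_nonneg hn'
  rw [le_div_iff₀ (by positivity), Real.rpow_def_of_pos hpos]
  nth_rewrite 2 [← Real.exp_log hpos]
  rw [← Real.exp_add, ← Real.exp_add, ← Real.exp_add]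
  have h1 : Real.log n * A + Real.log n + e + Real.log n * A ≤ 1 := by
    nlinarith [mul_nonneg hlog (sq_nonneg A)]
  linarith [Real.exp_le_exp.2 h1, Real.exp_one_lt_d9]

theorem sub_le_rpow_mul_exp {A : ℝ} (hA : 0 ≤ A) {s : ℕ → ℝ} (hmono : Monotone s)
    (hs : ∀ m : ℕ, 1 ≤ m → s m - s (m - 1) ≤ (m : ℝ) ^ A) {n : ℕ} (hn : 1 ≤ n) {x : ℝ}
    (hx : A + 1 ≤ x) (m : ℕ) :
    s m - s n ≤ (n : ℝ) ^ A * n * Real.exp (x / n * ((m : ℝ) - n)) := by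
  rcases le_total m n with hmn | hnm
  · exact (sub_nonpos.2 (hmono hmn)).trans (by positivity)
  have hpos : (0 : ℝ) < n := by exact_mod_cast hn
  have hk : (0 : ℝ) ≤ (m : ℝ) - n := sub_nonneg.2 (by exact_mod_cast hnm)
  set u : ℝ := ((m : ℝ) - n) / n with hu
  have hu0 : 0 ≤ u := by positivity
  have hm : (m : ℝ) = n * (1 + u) := by rw [hu]; field_simp; ring
  have h1 := sub_le_mul_rpow_of_increment_le hA hs hnm
  have h2 : u ≤ Real.exp u := by linarith [Real.add_one_le_exp u]
  have h3 : (1 + u) ^ A ≤ Real.exp u ^ A :=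
    Real.rpow_le_rpow (by positivity) (by linarith [Real.add_one_le_exp u]) hA
  have h4 := mul_le_mul h2 h3 (by positivity) (by positivity)
  rw [← Real.exp_mul, ← Real.exp_add] at h4
  have h5 : Real.exp (u + u * A) ≤ Real.exp (x / n * ((m : ℝ) - n)) := by
    rw [Real.exp_le_exp, show x / n * ((m : ℝ) - n) = x * u by rw [hu]; ring]
    nlinarith
  calc s m - s n ≤ ((m : ℝ) - n) * (m : ℝ) ^ A := h1
    _ = (n : ℝ) ^ A * n * (u * (1 + u) ^ A) := by
      rw [hm, Real.mul_rpow hpos.le (by positivity)]; ring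
    _ ≤ _ := mul_le_mul_of_nonneg_left (h4.trans h5) (by positivity)

theorem sub_le_rpow_mul_exp_neg {A : ℝ} (hA : 0 ≤ A) {s : ℕ → ℝ} (hmono : Monotone s)
    (hs : ∀ m : ℕ, 1 ≤ m → s m - s (m - 1) ≤ (m : ℝ) ^ A) {n : ℕ} (hn : 1 ≤ n) {x : ℝ}
    (hx : 1 ≤ x) (m : ℕ) :
    s n - s m ≤ (n : ℝ) ^ A * n * Real.exp (-(x / n) * ((m : ℝ) - n)) := by
  rcases le_total n m with hnm | hmn
  · exact (sub_nonpos.2 (hmono hnm)).trans (by positivity)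
  have hpos : (0 : ℝ) < n := by exact_mod_cast hn
  have hk : (0 : ℝ) ≤ (n : ℝ) - m := sub_nonneg.2 (by exact_mod_cast hmn)
  set u : ℝ := ((n : ℝ) - m) / n with hu
  have hu0 : 0 ≤ u := by positivity
  have h2 : u ≤ Real.exp (-(x / n) * ((m : ℝ) - n)) := by
    rw [show -(x / n) * ((m : ℝ) - n) = x * u by rw [hu]; ring]
    nlinarith [Real.add_one_le_exp (x * u)]
  calc s n - s m ≤ ((n : ℝ) - m) * (n : ℝ) ^ A := sub_le_mul_rpow_of_increment_le hA hs hmn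
    _ = (n : ℝ) ^ A * n * u := by rw [hu]; field_simp
    _ ≤ _ := mul_le_mul_of_nonneg_left h2 (by positivity)

/-- The exponent `n((1-u)(e^u-1)-u)` of the upper tail is at most `-nu²/2`. -/
theorem upper_tail_exponent_le {n u : ℝ} (hn : 0 ≤ n) (hu0 : 0 ≤ u) (hu1 : u ≤ 1) :
    (n - n * u) * (Real.exp u - 1) - u * n ≤ -(n * u ^ 2 / 2) := by
  have h := exp_le_cubic (abs_le.2 ⟨by linarith, hu1⟩)
  rw [abs_of_nonneg hu0] at h
  have h1 := mul_le_mul_of_nonneg_left h (mul_nonneg hn (sub_nonneg.2 hu1))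
  have h2 : 0 ≤ n * u ^ 3 := by positivity
  have h3 : 0 ≤ n * u ^ 4 := by positivity
  nlinarith

/-- The exponent `n((1+u)(e^{-u}-1)+u)` of the lower tail is at most `-nu²/2+nu³`. -/
theorem lower_tail_exponent_le {n u : ℝ} (hn : 0 ≤ n) (hu0 : 0 ≤ u) (hu1 : u ≤ 1) :
    (n + n * u) * (Real.exp (-u) - 1) - (-u) * n ≤ n * u ^ 3 - n * u ^ 2 / 2 := by
  have h := exp_le_cubic (t := -u) (abs_le.2 ⟨by linarith, by linarith⟩)
  rw [abs_neg, abs_of_nonneg hu0] at h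
  have h1 := mul_le_mul_of_nonneg_left h (mul_nonneg hn (by linarith : 0 ≤ 1 + u))
  have h2 : n * u ^ 4 ≤ n * u ^ 3 :=
    mul_le_mul_of_nonneg_left (pow_le_pow_of_le_one hu0 hu1 (by norm_num)) hn
  have h3 : 0 ≤ n * u ^ 3 := by positivity
  nlinarith

/-- Let `A ≥ 0`.  There is `n₀ = n₀(A)` such that: for every
non-decreasing sequence `s₀ ≤ s₁ ≤ ⋯` of reals with `s_m − s_{m−1} ≤ m^A` for all `m ≥ 1`,
and every integer `n ≥ n₀`,
`E[s̃_{λ⁻}] − 4/n^A ≤ s_n ≤ E[s̃_{λ⁺}] + 4/n^A`, where `λ± = n ± (A+1)√(2n log n)` and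
`s̃_λ = s_{Pois(λ)}`. -/
theorem stmt16 (A : ℝ) (hA : 0 ≤ A) :
    ∃ n₀ : ℕ, ∀ s : ℕ → ℝ, Monotone s →
      (∀ m : ℕ, 1 ≤ m → s m - s (m - 1) ≤ (m : ℝ) ^ A) →
      ∀ n : ℕ, n₀ ≤ n →
        poiExp s ((n : ℝ) - (A + 1) * Real.sqrt (2 * n * Real.log n)) - 4 / (n : ℝ) ^ A ≤ s n ∧
        s n ≤ poiExp s ((n : ℝ) + (A + 1) * Real.sqrt (2 * n * Real.log n)) + 4 / (n : ℝ) ^ A := by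
  obtain ⟨n₀, h₀⟩ := Filter.eventually_atTop.1 (eventually_deviation_bounds A hA)
  refine ⟨n₀, fun s hmono hs n hn => ?_⟩
  obtain ⟨h3, hxA, hx3⟩ := h₀ n hn
  have hn1 : 1 ≤ n := by omega
  have hn1' : (1 : ℝ) ≤ n := by exact_mod_cast hn1
  have hpos : (0 : ℝ) < n := by linarith
  have hlog : 0 ≤ Real.log n := Real.log_nonneg hn1'
  have hxsq : ((A + 1) * Real.sqrt (2 * n * Real.log n)) ^ 2 =
      (A + 1) ^ 2 * (2 * n * Real.log n) := by
    rw [mul_pow, Real.sq_sqrt (by positivity)]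
  set x := (A + 1) * Real.sqrt (2 * n * Real.log n) with hx
  have hx1 : 1 ≤ x := by linarith
  have hxn : x ≤ n := by
    by_contra! hlt
    have : (n : ℝ) ^ 3 < x ^ 3 := pow_lt_pow_left₀ hlt hpos.le (by norm_num)
    nlinarith [sq_nonneg (n : ℝ)]
  have hu0 : 0 ≤ x / n := by positivity
  have hu1 : x / n ≤ 1 := (div_le_one hpos).2 hxn
  have hnu : (n : ℝ) * (x / n) = x := by field_simp
  have hu2 : (n : ℝ) * (x / n) ^ 2 / 2 = (A + 1) ^ 2 * Real.log n := by
    rw [div_pow, hxsq]; field_simp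
  have hu3 : (n : ℝ) * (x / n) ^ 3 ≤ 1 := by
    rw [show (n : ℝ) * (x / n) ^ 3 = x ^ 3 / (n : ℝ) ^ 2 by field_simp]
    exact (div_le_one (by positivity)).2 hx3
  have hup := upper_tail_exponent_le hpos.le hu0 hu1
  have hlow := lower_tail_exponent_le hpos.le hu0 hu1
  rw [hnu] at hup hlow
  have hlam : 0 ≤ (n : ℝ) - x := by linarith
  have hlam' : 0 ≤ (n : ℝ) + x := by linarith
  constructor
  · have h := mul_poiExp_sub_le hlam (summable_poisson_mul hA hmono hs hlam) (c := 1)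
      (fun m => by
        rw [one_mul]
        exact sub_le_rpow_mul_exp hA hmono hs hn1 hxA m)
    linarith [rpow_mul_exp_le (A := A) hn1 (hup.trans (by linarith))]
  · have h := mul_poiExp_sub_le hlam' (summable_poisson_mul hA hmono hs hlam') (c := -1)
      (fun m => by
        rw [neg_one_mul, neg_sub]
        exact sub_le_rpow_mul_exp_neg hA hmono hs hn1 hx1 m)
    linarith [rpow_mul_exp_le (A := A) hn1 (hlow.trans (by linarith))]
end
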